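/- arXiv:2003.02726 — 3 statements merged into one kernel-verified Lean document; each statement's English description precedes it below -/
import Mathlib

section
/- Let R be a commutative ring (containing 1/2) with elements ∂_{μν} (1 ≤ μ,ν ≤ n), ∂_{μν} = -∂_{νμ}, and let ∂ denote the n×n matrix [∂_{μν}]. Define K_{(μν)(αβ)} = (1/2)(δ_{μα}∂_{νβ} - δ_{μβ}∂_{να} + δ_{νβ}∂_{μα} - δ_{να}∂_{μβ}) with powers (K⁰)_{(μν)(αβ)} = (1/2)(δ_{μα}δ_{νβ} - δ_{μβ}δ_{να}) and (K^m)_{(μν)(αβ)} = Σ_{θ,σ=1}^n K_{(μν)(θσ)}(K^{m-1})_{(θσ)(αβ)}. Then for every m ≥ 0, (K^m)_{(μν)(αβ)} = (1/2) Σ_{k=0}^m binom(m,k) ((∂^k)_{μα}(∂^{m-k})_{νβ} - (∂^{m-k})_{μβ}(∂^k)_{να}), where ∂^k denotes the ordinary k-th matrix power of ∂ (with ∂⁰ the identity matrix). -/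
/-- Kronecker delta with values in a ring. -/
def kd {R : Type*} [CommRing R] {n : ℕ} (a b : Fin n) : R := if a = b then 1 else 0

/-- `K_{(μν)(αβ)} = (1/2)(δ_{μα}∂_{νβ} - δ_{μβ}∂_{να} + δ_{νβ}∂_{μα} - δ_{να}∂_{μβ})`. -/
noncomputable def Kop {R : Type*} [CommRing R] [Invertible (2 : R)] {n : ℕ}
    (d : Fin n → Fin n → R) (μ ν α β : Fin n) : R :=
  ⅟(2 : R) * (kd μ α * d ν β - kd μ β * d ν α + kd ν β * d μ α - kd ν α * d μ β)

/-- Powers of `K`. -/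
noncomputable def Kpow {R : Type*} [CommRing R] [Invertible (2 : R)] {n : ℕ}
    (d : Fin n → Fin n → R) : ℕ → Fin n → Fin n → Fin n → Fin n → R
  | 0 => fun μ ν α β => ⅟(2 : R) * (kd μ α * kd ν β - kd μ β * kd ν α)
  | m+1 => fun μ ν α β => ∑ θ, ∑ σ, Kop d μ ν θ σ * Kpow d m θ σ α β

/-- Ordinary matrix powers of the `n×n` matrix `∂ = [∂_{μν}]` (with `∂⁰` the identity). -/
noncomputable def dpow {R : Type*} [CommRing R] {n : ℕ}
    (d : Fin n → Fin n → R) : ℕ → Fin n → Fin n → R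
  | 0 => fun μ ν => kd μ ν
  | m+1 => fun μ ν => ∑ α, dpow d m μ α * d α ν

/-- Left multiplication by `d` also raises the matrix power by one. -/
theorem sum_mul_dpow {R : Type*} [CommRing R] {n : ℕ} (d : Fin n → Fin n → R) (k : ℕ)
    (μ α : Fin n) : ∑ θ, d μ θ * dpow d k θ α = dpow d (k + 1) μ α := by
  induction k generalizing α with
  | zero => simp [dpow, kd]
  | succ k ih =>
    calc ∑ θ, d μ θ * dpow d (k + 1) θ α
        = ∑ θ, ∑ σ, d μ θ * (dpow d k θ σ * d σ α) :=
          Finset.sum_congr rfl fun θ _ => Finset.mul_sum _ _ _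
      _ = ∑ σ, (∑ θ, d μ θ * dpow d k θ σ) * d σ α := by
          rw [Finset.sum_comm]
          simp_rw [Finset.sum_mul, mul_assoc]
      _ = ∑ σ, dpow d (k + 1) μ σ * d σ α := by simp_rw [ih]

/-- The antisymmetrized product of the `k`-th and `l`-th matrix powers of `d`. -/
noncomputable def wedgePow {R : Type*} [CommRing R] {n : ℕ} (d : Fin n → Fin n → R)
    (α β : Fin n) (k l : ℕ) (μ ν : Fin n) : R :=
  dpow d k μ α * dpow d l ν β - dpow d l μ β * dpow d k ν α

theorem wedgePow_swap {R : Type*} [CommRing R] {n : ℕ} (d : Fin n → Fin n → R)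
    (α β : Fin n) (k l : ℕ) (μ ν : Fin n) :
    wedgePow d α β k l ν μ = -wedgePow d α β k l μ ν := by
  unfold wedgePow; ring

/-- On antisymmetric arrays `K` acts as the derivation `d ⊗ 1 + 1 ⊗ d`. -/
theorem sum_Kop_mul {R : Type*} [CommRing R] [Invertible (2 : R)] {n : ℕ}
    (d X : Fin n → Fin n → R) (hX : ∀ μ ν, X ν μ = -X μ ν) (μ ν : Fin n) :
    ∑ θ, ∑ σ, Kop d μ ν θ σ * X θ σ = ∑ σ, d ν σ * X μ σ + ∑ θ, d μ θ * X θ ν := by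
  have h : ∑ θ, ∑ σ, Kop d μ ν θ σ * X θ σ =
      ⅟(2 : R) * (∑ σ, d ν σ * X μ σ - ∑ θ, d ν θ * X θ μ
        + ∑ θ, d μ θ * X θ ν - ∑ σ, d μ σ * X ν σ) := by
    simp only [Kop, kd, mul_assoc, ← Finset.mul_sum, sub_mul, add_mul, Finset.sum_sub_distrib,
      Finset.sum_add_distrib, ite_mul, one_mul, zero_mul, Finset.sum_ite_eq, Finset.mem_univ,
      if_true]
    congr 1
    simp [Finset.sum_ite_irrel]
  have h₁ : ∑ θ, d ν θ * X θ μ = -∑ σ, d ν σ * X μ σ := by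
    simp [hX μ, Finset.sum_neg_distrib]
  have h₂ : ∑ σ, d μ σ * X ν σ = -∑ θ, d μ θ * X θ ν := by
    simp [hX _ ν, Finset.sum_neg_distrib]
  rw [h, h₁, h₂]
  linear_combination (∑ σ, d ν σ * X μ σ + ∑ θ, d μ θ * X θ ν) * invOf_mul_self (2 : R)

theorem sum_Kop_mul_wedgePow {R : Type*} [CommRing R] [Invertible (2 : R)] {n : ℕ}
    (d : Fin n → Fin n → R) (α β : Fin n) (k l : ℕ) (μ ν : Fin n) :
    ∑ θ, ∑ σ, Kop d μ ν θ σ * wedgePow d α β k l θ σ =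
      wedgePow d α β k (l + 1) μ ν + wedgePow d α β (k + 1) l μ ν := by
  rw [sum_Kop_mul d _ (wedgePow_swap d α β k l)]
  simp only [wedgePow, ← sum_mul_dpow d k, ← sum_mul_dpow d l, Finset.mul_sum, Finset.sum_mul,
    ← Finset.sum_sub_distrib, ← Finset.sum_add_distrib]
  refine Finset.sum_congr rfl fun θ _ => ?_
  ring

theorem Kpow_eq_sum_antidiagonal {R : Type*} [CommRing R] [Invertible (2 : R)] {n : ℕ}
    (d : Fin n → Fin n → R) (m : ℕ) (μ ν α β : Fin n) :
    Kpow d m μ ν α β = ⅟(2 : R) * ∑ p ∈ Finset.HasAntidiagonal.antidiagonal m,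
      (m.choose p.1 : R) * wedgePow d α β p.1 p.2 μ ν := by
  induction m generalizing μ ν with
  | zero => simp [Kpow, wedgePow, dpow]
  | succ m ih =>
    rw [Finset.sum_antidiagonal_choose_succ_mul (fun k l => wedgePow d α β k l μ ν)]
    have hsymm : ∑ p ∈ Finset.HasAntidiagonal.antidiagonal m,
          (m.choose p.2 : R) * wedgePow d α β (p.1 + 1) p.2 μ ν =
        ∑ p ∈ Finset.HasAntidiagonal.antidiagonal m,
          (m.choose p.1 : R) * wedgePow d α β (p.1 + 1) p.2 μ ν := by
      refine Finset.sum_congr rfl fun p hp => ?_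
      rw [Nat.choose_symm_of_eq_add (Finset.HasAntidiagonal.mem_antidiagonal.mp hp).symm]
    rw [hsymm, ← Finset.sum_add_distrib]
    simp_rw [← mul_add, ← sum_Kop_mul_wedgePow]
    calc ∑ θ, ∑ σ, Kop d μ ν θ σ * Kpow d m θ σ α β
        = ∑ θ, ∑ σ, ∑ p ∈ Finset.HasAntidiagonal.antidiagonal m,
            ⅟(2 : R) * ((m.choose p.1 : R) *
              (Kop d μ ν θ σ * wedgePow d α β p.1 p.2 θ σ)) := by
          simp_rw [ih, Finset.mul_sum]
          refine Finset.sum_congr rfl fun θ _ => Finset.sum_congr rfl fun σ _ =>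
            Finset.sum_congr rfl fun p _ => ?_
          ring
      _ = ∑ θ, ∑ p ∈ Finset.HasAntidiagonal.antidiagonal m, ∑ σ,
            ⅟(2 : R) * ((m.choose p.1 : R) *
              (Kop d μ ν θ σ * wedgePow d α β p.1 p.2 θ σ)) :=
          Finset.sum_congr rfl fun θ _ => Finset.sum_comm
      _ = _ := by
          rw [Finset.sum_comm]
          simp_rw [Finset.mul_sum]

/-- Proposition A1:
`(K^m)_{(μν)(αβ)} = (1/2) Σ_{k=0}^m binom(m,k)((∂^k)_{μα}(∂^{m-k})_{νβ} - (∂^{m-k})_{μβ}(∂^k)_{να})`. -/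
theorem statement6 {R : Type*} [CommRing R] [Invertible (2 : R)]
    (n : ℕ) (hn : 2 ≤ n)
    (d : Fin n → Fin n → R) (hd : ∀ μ ν, d μ ν = - d ν μ) :
    ∀ (m : ℕ) (μ ν α β : Fin n),
      Kpow d m μ ν α β
        = ⅟(2 : R) * ∑ k ∈ Finset.range (m+1), (m.choose k : R) *
            (dpow d k μ α * dpow d (m-k) ν β - dpow d (m-k) μ β * dpow d k ν α) := by
  intro m μ ν α β
  rw [Kpow_eq_sum_antidiagonal, Finset.Nat.sum_antidiagonal_eq_sum_range_succ
    (fun k l => (m.choose k : R) * wedgePow d α β k l μ ν)]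
  rfl
end

section
/- Let η = diag(-1,1,…,1) be the Minkowski metric on ℝ^n. Let P = ℝ[x_{μν} : 1 ≤ μ < ν ≤ n] with x_{νμ} := -x_{μν}, x_{μμ} := 0, and let ∂_{μν} (∂_{νμ} = -∂_{μν}) be the unique derivations of P satisfying [∂_{μν}, x_{αβ}] = η_{μα}η_{νβ} - η_{μβ}η_{να} (namely ∂_{μν} = η_{μμ}η_{νν} ∂/∂x_{μν}, no summation). Define K_{(μν)(αβ)} = (1/2)(η_{μα}∂_{νβ} - η_{μβ}∂_{να} + η_{νβ}∂_{μα} - η_{να}∂_{μβ}) with η-contracted powers (K⁰)_{(μν)(αβ)} = (1/2)(η_{μα}η_{νβ} - η_{μβ}η_{να})·id and (K^m)_{(μν)(αβ)} = Σ_{λ,ρ,λ',ρ'} K_{(μν)(λρ)} η_{λλ'} η_{ρρ'} (K^{m-1})_{(λ'ρ')(αβ)}, and the locally finite sum ψ(K)_{(μν)(αβ)} = Σ_{k≥0} ((-1)^k B_k/k!)(K^k)_{(μν)(αβ)}. Then the operators M̂_{μν} = Σ_{α,β} Σ_{α',β'} x_{αβ} η_{αα'} η_{ββ'} ∘ ψ(K)_{(μν)(α'β')}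 satisfy the Lorentz algebra so(1,n-1) relations: [M̂_{μν}, M̂_{λρ}] = η_{νλ} M̂_{μρ} - η_{μλ} M̂_{νρ} - η_{νρ} M̂_{μλ} + η_{μρ} M̂_{νλ}. -/
open MvPolynomial

/-- Index set for the variables `x_{μν}`, `1 ≤ μ < ν ≤ n`. -/
abbrev PairIdx (n : ℕ) := {q : Fin n × Fin n // q.1 < q.2}

/-- The polynomial algebra `P = ℝ[x_{μν} : 1 ≤ μ < ν ≤ n]`. -/
abbrev PolyH (n : ℕ) := MvPolynomial (PairIdx n) ℝ

/-- The Minkowski metric `η = diag(-1,1,…,1)`. -/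
def etaM {n : ℕ} (μ ν : Fin n) : ℝ :=
  if μ = ν then (if (μ : ℕ) = 0 then -1 else 1) else 0

/-- The antisymmetric family of variables: `x_{νμ} = -x_{μν}`, `x_{μμ} = 0`. -/
noncomputable def xv {n : ℕ} (μ ν : Fin n) : PolyH n :=
  if h : μ < ν then X ⟨(μ, ν), h⟩ else if h : ν < μ then - X ⟨(ν, μ), h⟩ else 0

/-- The derivations `∂_{μν} = η_{μμ}η_{νν} ∂/∂x_{μν}` (no summation), with
`∂_{νμ} = -∂_{μν}`; they satisfy `[∂_{μν},x_{αβ}] = η_{μα}η_{νβ} - η_{μβ}η_{να}`. -/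
noncomputable def dopL {n : ℕ} (μ ν : Fin n) : PolyH n → PolyH n := fun p =>
  if h : μ < ν then (etaM μ μ * etaM ν ν) • pderiv ⟨(μ, ν), h⟩ p
  else if h : ν < μ then - ((etaM μ μ * etaM ν ν) • pderiv ⟨(ν, μ), h⟩ p) else 0

/-- `K_{(μν)(αβ)} = (1/2)(η_{μα}∂_{νβ} - η_{μβ}∂_{να} + η_{νβ}∂_{μα} - η_{να}∂_{μβ})`. -/
noncomputable def KopL {n : ℕ} (μ ν α β : Fin n) : PolyH n → PolyH n := fun p =>
  (1/2 : ℝ) • (etaM μ α • dopL ν β p - etaM μ β • dopL ν α p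
    + etaM ν β • dopL μ α p - etaM ν α • dopL μ β p)

/-- `η`-contracted powers of `K`: `(K⁰)_{(μν)(αβ)} = (1/2)(η_{μα}η_{νβ} - η_{μβ}η_{να})·id`,
`(K^m)_{(μν)(αβ)} = Σ K_{(μν)(λρ)} η_{λλ'} η_{ρρ'} (K^{m-1})_{(λ'ρ')(αβ)}`. -/
noncomputable def KpowL {n : ℕ} : ℕ → Fin n → Fin n → Fin n → Fin n → (PolyH n → PolyH n)
  | 0 => fun μ ν α β p => ((1/2 : ℝ) * (etaM μ α * etaM ν β - etaM μ β * etaM ν α)) • p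
  | m+1 => fun μ ν α β p => ∑ lam, ∑ ρ, ∑ lam', ∑ ρ',
      (etaM lam lam' * etaM ρ ρ') • KopL μ ν lam ρ (KpowL m lam' ρ' α β p)

/-- The coefficient `(-1)^k B_k / k!` of `ψ(t) = t/(1-e^{-t})` (`B₁ = -1/2`). -/
noncomputable def bcoef (k : ℕ) : ℝ := (-1 : ℝ)^k * ((bernoulli k : ℚ) : ℝ) / (k.factorial : ℝ)

/-- `ψ(K)_{(μν)(αβ)} = Σ_{k≥0} ((-1)^k B_k/k!)(K^k)_{(μν)(αβ)}`, a locally finite sum. -/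
noncomputable def psiKL {n : ℕ} (μ ν α β : Fin n) : PolyH n → PolyH n := fun p =>
  ∑ᶠ k : ℕ, bcoef k • KpowL k μ ν α β p

/-- The Weyl realization of the Lorentz algebra:
`M̂_{μν} = Σ x_{αβ} η_{αα'} η_{ββ'} ∘ ψ(K)_{(μν)(α'β')}`. -/
noncomputable def MhatL {n : ℕ} (μ ν : Fin n) : PolyH n → PolyH n := fun p =>
  ∑ α, ∑ β, ∑ α', ∑ β', (etaM α α' * etaM β β') • (xv α β * psiKL μ ν α' β' p)

namespace WeylLorentz

section Bernoulli

open PowerSeries Finset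

variable {R : Type*} [CommRing R] [Algebra ℚ R]

/-- The Taylor coefficients of `z / (exp z - 1)`. -/
noncomputable def todd (k : ℕ) : ℚ := bernoulli k / (k.factorial : ℚ)

lemma rescale_bernoulliPowerSeries_mul (u : R) :
    rescale u (bernoulliPowerSeries R) * (rescale u (exp R) - 1)
      = PowerSeries.C u * PowerSeries.X := by
  have h := congrArg (rescale u) (bernoulliPowerSeries_mul_exp_sub_one R)
  rwa [map_mul, map_sub, map_one, rescale_X] at h

lemma rescale_exp_sub_one_ne_zero {u : R} (hu : u ≠ 0) : rescale u (exp R) - 1 ≠ 0 := by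
  intro h
  have := congrArg (PowerSeries.coeff 1) h
  simp [coeff_rescale, coeff_exp, PowerSeries.coeff_one] at this
  exact hu this

variable [IsDomain R]

/-- The functional equation of `z / (exp z - 1)` under addition of arguments. -/
lemma bernoulliPowerSeries_add {u w : R} (hu : u ≠ 0) (hw : w ≠ 0) (huw : u + w ≠ 0) :
    PowerSeries.C w * (rescale u (bernoulliPowerSeries R) *
        (rescale (u + w) (bernoulliPowerSeries R) - rescale w (bernoulliPowerSeries R)))
      + PowerSeries.C u * (rescale w (bernoulliPowerSeries R) *
        (rescale (u + w) (bernoulliPowerSeries R) - rescale u (bernoulliPowerSeries R)))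
      = - (PowerSeries.C u * PowerSeries.C w * PowerSeries.X *
          rescale (u + w) (bernoulliPowerSeries R)) := by
  have h₁ := rescale_bernoulliPowerSeries_mul u
  have h₂ := rescale_bernoulliPowerSeries_mul w
  have h₃ := rescale_bernoulliPowerSeries_mul (u + w)
  have n₁ := rescale_exp_sub_one_ne_zero hu
  have n₂ := rescale_exp_sub_one_ne_zero hw
  have n₃ := rescale_exp_sub_one_ne_zero huw
  rw [← exp_mul_exp_eq_exp_add, map_add] at h₃
  rw [← exp_mul_exp_eq_exp_add] at n₃
  generalize rescale u (bernoulliPowerSeries R) = F at *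
  generalize rescale w (bernoulliPowerSeries R) = G at *
  generalize rescale (u + w) (bernoulliPowerSeries R) = S at *
  generalize rescale u (exp R) = a at *
  generalize rescale w (exp R) = b at *
  refine mul_right_cancel₀ n₁ (mul_right_cancel₀ n₂ (mul_right_cancel₀ n₃ ?_))
  linear_combination
    (PowerSeries.C w * (b - 1) * (a * b - 1) * (S - G)
      - PowerSeries.C u * G * (b - 1) * (a * b - 1)) * h₁
    + (PowerSeries.C u * (a - 1) * (a * b - 1) * S
      - PowerSeries.C w * (a * b - 1) * PowerSeries.C u * PowerSeries.X
      - PowerSeries.C u * (a * b - 1) * PowerSeries.C u * PowerSeries.X) * h₂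
    + PowerSeries.C u * PowerSeries.C w * PowerSeries.X * (a * b - 1) * h₃

lemma sum_todd_mul_todd {u w : R} (hu : u ≠ 0) (hw : w ≠ 0) (huw : u + w ≠ 0) (m : ℕ) :
    ∑ q ∈ antidiagonal (m + 1), algebraMap ℚ R (todd q.1 * todd q.2) *
        (u ^ q.2 * (∑ i ∈ range q.1, w ^ i * (u + w) ^ (q.1 - 1 - i))
          + w ^ q.1 * (∑ i ∈ range q.2, u ^ i * (u + w) ^ (q.2 - 1 - i)))
      = - (algebraMap ℚ R (todd m) * (u + w) ^ m) := by
  have h := congrArg (PowerSeries.coeff (m + 1)) (bernoulliPowerSeries_add hu hw huw)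
  rw [mul_comm (rescale u _), mul_assoc (PowerSeries.C u * PowerSeries.C w),
    mul_assoc (PowerSeries.C u), map_add, map_neg,
    PowerSeries.coeff_C_mul, PowerSeries.coeff_C_mul, PowerSeries.coeff_C_mul,
    PowerSeries.coeff_C_mul, PowerSeries.coeff_succ_X_mul, PowerSeries.coeff_mul,
    PowerSeries.coeff_mul] at h
  simp only [map_sub, coeff_rescale, bernoulliPowerSeries, PowerSeries.coeff_mk] at h
  refine mul_left_cancel₀ (mul_ne_zero hu hw) ?_
  refine Eq.trans ?_ (h.trans (by rw [todd]; ring))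
  simp only [mul_sum (antidiagonal _), ← sum_add_distrib]
  refine sum_congr rfl fun q _ => ?_
  have h₁ := geom_sum₂_mul w (u + w) q.1
  have h₂ := geom_sum₂_mul u (u + w) q.2
  generalize ∑ i ∈ range q.1, w ^ i * (u + w) ^ (q.1 - 1 - i) = A at *
  generalize ∑ i ∈ range q.2, u ^ i * (u + w) ^ (q.2 - 1 - i) = B at *
  simp only [todd, map_mul]
  linear_combination
    - algebraMap ℚ R (bernoulli q.1 / (q.1.factorial : ℚ)) *
      algebraMap ℚ R (bernoulli q.2 / (q.2.factorial : ℚ)) *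
        (w * u ^ q.2 * h₁ + u * w ^ q.1 * h₂)

end Bernoulli

section BracketCalculus

open Finset

variable {𝔤 : Type*} [LieRing 𝔤] [LieAlgebra ℝ 𝔤]

/-- The iterated bracket `(ad t)^k a`. -/
noncomputable def adPow (t : 𝔤) (k : ℕ) : 𝔤 →ₗ[ℝ] 𝔤 := (LieAlgebra.ad ℝ 𝔤 t : 𝔤 →ₗ[ℝ] 𝔤) ^ k

@[simp] lemma adPow_zero (t a : 𝔤) : adPow t 0 a = a := by simp [adPow]

lemma adPow_succ (t a : 𝔤) (k : ℕ) : adPow t (k + 1) a = ⁅t, adPow t k a⁆ := by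
  simp [adPow, pow_succ']

/-- The linear map sending `u ^ i * w ^ j` to `⁅(ad t)^i b, (ad t)^j a⁆`. -/
noncomputable def bracketMap (t b a : 𝔤) : MvPolynomial (Fin 2) ℝ →ₗ[ℝ] 𝔤 :=
  (basisMonomials (Fin 2) ℝ).constr ℝ fun s => ⁅adPow t (s 0) b, adPow t (s 1) a⁆

lemma bracketMap_monomial (t b a : 𝔤) (s : Fin 2 →₀ ℕ) :
    bracketMap t b a (monomial s 1) = ⁅adPow t (s 0) b, adPow t (s 1) a⁆ := by
  have := (basisMonomials (Fin 2) ℝ).constr_basis ℝ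
    (fun s => ⁅adPow t (s 0) b, adPow t (s 1) a⁆) s
  rwa [coe_basisMonomials] at this

lemma bracketMap_X_pow_mul (t b a : 𝔤) (i j : ℕ) :
    bracketMap t b a (X 0 ^ i * X 1 ^ j) = ⁅adPow t i b, adPow t j a⁆ := by
  have h : (X 0 ^ i * X 1 ^ j : MvPolynomial (Fin 2) ℝ)
      = monomial (Finsupp.single 0 i + Finsupp.single 1 j) 1 := by
    simp [X_pow_eq_monomial, monomial_mul]
  rw [h, bracketMap_monomial]
  simp

lemma bracketMap_add_mul (t b a : 𝔤) (p : MvPolynomial (Fin 2) ℝ) :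
    bracketMap t b a ((X 0 + X 1) * p) = ⁅t, bracketMap t b a p⁆ := by
  have h : (bracketMap t b a) ∘ₗ LinearMap.mulLeft ℝ (X 0 + X 1)
      = (LieAlgebra.ad ℝ 𝔤 t).comp (bracketMap t b a) := by
    refine (basisMonomials (Fin 2) ℝ).ext fun s => ?_
    simp only [coe_basisMonomials, LinearMap.comp_apply, LinearMap.mulLeft_apply, add_mul,
      map_add, LieAlgebra.ad_apply, bracketMap_monomial, X, monomial_mul, one_mul]
    simp [adPow_succ, add_comm 1]
  exact LinearMap.congr_fun h p

lemma bracketMap_add_pow (t b a : 𝔤) (m : ℕ) :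
    bracketMap t b a ((X 0 + X 1) ^ m) = adPow t m ⁅b, a⁆ := by
  induction m with
  | zero => simpa using bracketMap_X_pow_mul t b a 0 0
  | succ m ih => rw [pow_succ', bracketMap_add_mul, ih, adPow_succ]

/-- If `d` is a derivation with `d t = (ad t)^l b` and `d a = 0`, then `d ((ad t)^k a)` is
a divided difference of the bracket. -/
lemma derivation_adPow (t a b : 𝔤) (d : 𝔤 → 𝔤) (hd : ∀ x y, d ⁅x, y⁆ = ⁅d x, y⁆ + ⁅x, d y⁆)
    (l : ℕ) (ht : d t = adPow t l b) (ha : d a = 0) (k : ℕ) :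
    d (adPow t k a) = bracketMap t b a
      (X 0 ^ l * ∑ i ∈ range k, X 1 ^ i * (X 0 + X 1) ^ (k - 1 - i)) := by
  induction k with
  | zero => simp [ha]
  | succ k ih =>
    rw [adPow_succ, hd, ht, ih, ← bracketMap_X_pow_mul, ← bracketMap_add_mul, ← map_add,
      add_tsub_cancel_right, geom_sum₂_succ_eq]
    congr 1
    ring

lemma derivation_adPow_swap (t a b : 𝔤) (d : 𝔤 → 𝔤) (hd : ∀ x y, d ⁅x, y⁆ = ⁅d x, y⁆ + ⁅x, d y⁆)
    (l : ℕ) (ht : d t = adPow t l a) (hb : d b = 0) (k : ℕ) :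
    d (adPow t k b) = - bracketMap t b a
      (X 1 ^ l * ∑ i ∈ range k, X 0 ^ i * (X 0 + X 1) ^ (k - 1 - i)) := by
  induction k with
  | zero => simp [hb]
  | succ k ih =>
    rw [adPow_succ, hd, ht, ih, ← lie_skew, ← bracketMap_X_pow_mul, lie_neg, ← bracketMap_add_mul,
      ← neg_add, ← map_add, add_tsub_cancel_right, geom_sum₂_succ_eq]
    congr 2
    ring

/-- The Maurer-Cartan equation for the vector fields `(z / (exp z - 1)) (ad t) a`, in each
degree. -/
lemma sum_todd_derivation (t a b : 𝔤) (da db : ℕ → 𝔤 → 𝔤)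
    (hda : ∀ l x y, da l ⁅x, y⁆ = ⁅da l x, y⁆ + ⁅x, da l y⁆)
    (hdb : ∀ l x y, db l ⁅x, y⁆ = ⁅db l x, y⁆ + ⁅x, db l y⁆)
    (hat : ∀ l, da l t = adPow t l a) (hbt : ∀ l, db l t = adPow t l b)
    (hab : ∀ l, da l b = 0) (hba : ∀ l, db l a = 0) (m : ℕ) :
    ∑ q ∈ antidiagonal (m + 1), ((todd q.1 * todd q.2 : ℚ) : ℝ) •
        (db q.2 (adPow t q.1 a) - da q.1 (adPow t q.2 b))
      = (todd m : ℝ) • adPow t m ⁅a, b⁆ := by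
  have hX : (X 0 + X 1 : MvPolynomial (Fin 2) ℝ) ≠ 0 := by
    intro h
    have := congrArg (MvPolynomial.eval fun _ => (1 : ℝ)) h
    norm_num at this
  have h := congrArg (bracketMap t b a)
    (sum_todd_mul_todd (MvPolynomial.X_ne_zero (R := ℝ) (0 : Fin 2)) (MvPolynomial.X_ne_zero 1)
      hX m)
  have hc : ∀ (c : ℚ) (p : MvPolynomial (Fin 2) ℝ), algebraMap ℚ _ c * p = (c : ℝ) • p := by
    intro c p
    rw [← Algebra.smul_def, ← Rat.cast_smul_eq_qsmul ℝ]
  simp only [hc, map_sum, map_smul, map_neg, bracketMap_add_pow] at h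
  rw [← lie_skew a b, map_neg, smul_neg, ← h]
  refine sum_congr rfl fun q _ => ?_
  rw [derivation_adPow t a b _ (hdb _) _ (hbt _) (hba _),
    derivation_adPow_swap t a b _ (hda _) _ (hat _) (hab _), sub_neg_eq_add, ← map_add]

end BracketCalculus

section Symbols

open Finset
open scoped IsMulCommutative

variable {σ : Type*}

lemma pderiv_comm (i j : σ) (p : MvPolynomial σ ℝ) :
    pderiv i (pderiv j p) = pderiv j (pderiv i p) := by
  classical
  have h : ⁅(pderiv i : Derivation ℝ (MvPolynomial σ ℝ) (MvPolynomial σ ℝ)),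
      (pderiv j : Derivation ℝ (MvPolynomial σ ℝ) (MvPolynomial σ ℝ))⁆ = 0 := by
    refine MvPolynomial.derivation_ext (R := ℝ) fun k => ?_
    simp [Derivation.commutator_apply, Pi.single_apply, apply_ite]
  have := DFunLike.congr_fun h p
  simpa [Derivation.commutator_apply, sub_eq_zero] using this

/-- The commutative algebra of constant-coefficient differential operators. -/
noncomputable abbrev diffAlg (σ : Type*) : Subalgebra ℝ (Module.End ℝ (MvPolynomial σ ℝ)) :=
  Algebra.adjoin ℝ (Set.range fun i : σ =>
    ((pderiv i : Derivation ℝ (MvPolynomial σ ℝ) (MvPolynomial σ ℝ)) :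
      Module.End ℝ (MvPolynomial σ ℝ)))

instance : IsMulCommutative (diffAlg σ) :=
  Algebra.isMulCommutative_adjoin ℝ <| by
    rintro _ ⟨i, rfl⟩ _ ⟨j, rfl⟩
    exact LinearMap.ext fun p => pderiv_comm i j p

/-- The differential operator with constant coefficients whose symbol is a given polynomial. -/
noncomputable def symb : MvPolynomial σ ℝ →ₐ[ℝ] Module.End ℝ (MvPolynomial σ ℝ) :=
  (diffAlg σ).val.comp
    (aeval (S₁ := diffAlg σ) fun i => ⟨_, Algebra.subset_adjoin ⟨i, rfl⟩⟩)

@[simp] lemma symb_X (i : σ) (p : MvPolynomial σ ℝ) : symb (X i) p = pderiv i p := by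
  simp [symb]

lemma symb_mul_apply (f g p : MvPolynomial σ ℝ) : symb (f * g) p = symb f (symb g p) := by
  simp

lemma symb_X_mul (f : MvPolynomial σ ℝ) (i : σ) (p : MvPolynomial σ ℝ) :
    symb f (X i * p) = X i * symb f p + symb (pderiv i f) p := by
  classical
  induction f using MvPolynomial.induction_on generalizing p with
  | C r => simp
  | add f g hf hg => simp [hf, hg]; ring
  | mul_X f j hf =>
    rw [symb_mul_apply, symb_mul_apply, symb_X, symb_X, pderiv_mul, pderiv_mul, map_add, hf,
      pderiv_X, pderiv_X, map_add, LinearMap.add_apply, symb_mul_apply, symb_X]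
    by_cases h : i = j
    · subst h
      simp
      ring
    · simp [h, Ne.symm h]

/-- The polynomials annihilated by all homogeneous differential operators of order at least `d`. -/
def killedBy (d : ℕ) : Submodule ℝ (MvPolynomial σ ℝ) where
  carrier := {p | ∀ k, d ≤ k → ∀ f : MvPolynomial σ ℝ, f.IsHomogeneous k → symb f p = 0}
  add_mem' hp hq k hk f hf := by rw [map_add, hp k hk f hf, hq k hk f hf, add_zero]
  zero_mem' k _ f _ := map_zero _
  smul_mem' r p hp k hk f hf := by rw [map_smul, hp k hk f hf, smul_zero]

lemma killedBy_mono {d e : ℕ} (h : d ≤ e) : killedBy (σ := σ) d ≤ killedBy e :=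
  fun _ hp k hk => hp k (h.trans hk)

lemma symb_mem_killedBy {d e k : ℕ} {f p : MvPolynomial σ ℝ} (hf : f.IsHomogeneous k)
    (hp : p ∈ killedBy d) (h : d ≤ k + e) : symb f p ∈ killedBy e := by
  intro j hj g hg
  rw [← symb_mul_apply]
  exact hp (j + k) (by lia) _ (hg.mul hf)

lemma X_mul_mem_killedBy {d : ℕ} {p : MvPolynomial σ ℝ} (i : σ) (hp : p ∈ killedBy d) :
    X i * p ∈ killedBy (d + 1) := by
  intro k hk f hf
  rw [symb_X_mul, hp k (by lia) f hf, hp (k - 1) (by lia) _ hf.pderiv, mul_zero, add_zero]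

lemma symb_C_right (f : MvPolynomial σ ℝ) (r : ℝ) : symb f (C r) = C (coeff 0 f * r) := by
  induction f using MvPolynomial.induction_on with
  | C s => simp [smul_eq_C_mul]
  | add f g hf hg => simp [hf, hg, add_mul]
  | mul_X f j hf => classical simp [coeff_mul_X']

lemma exists_mem_killedBy (p : MvPolynomial σ ℝ) : ∃ d, p ∈ killedBy d := by
  induction p using MvPolynomial.induction_on with
  | C r =>
    refine ⟨1, fun k hk f hf => ?_⟩
    rw [symb_C_right, hf.coeff_eq_zero, zero_mul, C_0]
    simp; lia
  | add p q hp hq =>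
    obtain ⟨d, hd⟩ := hp
    obtain ⟨e, he⟩ := hq
    exact ⟨max d e, add_mem (killedBy_mono (le_max_left ..) hd)
      (killedBy_mono (le_max_right ..) he)⟩
  | mul_X p i hp =>
    obtain ⟨d, hd⟩ := hp
    exact ⟨d + 1, mul_comm p (X i) ▸ X_mul_mem_killedBy i hd⟩

end Symbols

section Operators

open Finset

variable {n : ℕ}

/-- The derivation dual to the antisymmetric family `xv` of variables. -/
noncomputable def dxv (γ δ : Fin n) : Derivation ℝ (PolyH n) (PolyH n) :=
  if h : γ < δ then pderiv ⟨(γ, δ), h⟩ else if h : δ < γ then - pderiv ⟨(δ, γ), h⟩ else 0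

lemma symb_xv_mul (f p : PolyH n) (γ δ : Fin n) :
    symb f (xv γ δ * p) = xv γ δ * symb f p + symb (dxv γ δ f) p := by
  unfold xv dxv
  split_ifs
  · exact symb_X_mul f _ p
  · simp [symb_X_mul, add_comm]
  · simp

lemma xv_swap (α β : Fin n) : xv β α = - xv α β := by
  unfold xv
  rcases lt_trichotomy α β with h | h | h <;> simp [h, h.not_gt]

lemma dxv_xv (γ δ α β : Fin n) :
    dxv γ δ (xv α β) = (if γ = α then if δ = β then 1 else 0 else 0)
      - (if γ = β then if δ = α then 1 else 0 else 0) := by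
  unfold xv dxv
  rcases lt_trichotomy γ δ with h | h | h <;> rcases lt_trichotomy α β with h' | h' | h' <;>
    simp [h, h', h.not_gt, h'.not_gt, Pi.single_apply] <;> grind

lemma dopL_eq (μ ν : Fin n) (p : PolyH n) :
    dopL μ ν p = (etaM μ μ * etaM ν ν) • symb (xv μ ν) p := by
  unfold dopL xv
  split_ifs <;> simp

/-- The vector field with components `W`, with each unordered pair counted once. -/
noncomputable def vecField (W : Matrix (Fin n) (Fin n) (PolyH n)) :
    Derivation ℝ (PolyH n) (PolyH n) :=
  (1 / 2 : ℝ) • ∑ γ, ∑ δ, W γ δ • dxv γ δ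

lemma vecField_apply (W : Matrix (Fin n) (Fin n) (PolyH n)) (f : PolyH n) :
    vecField W f = (1 / 2 : ℝ) • ∑ γ, ∑ δ, W γ δ * dxv γ δ f := by
  simp only [vecField, Derivation.smul_apply, ← Derivation.coeFnAddMonoidHom_apply, map_sum,
    Finset.sum_apply]
  simp

lemma vecField_xv {W : Matrix (Fin n) (Fin n) (PolyH n)} (hW : W.transpose = -W) (α β : Fin n) :
    vecField W (xv α β) = W α β := by
  have h : W β α = - W α β := congrFun (congrFun hW α) β
  simp only [vecField_apply, dxv_xv, mul_sub, mul_ite, mul_one, mul_zero, sum_sub_distrib]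
  simp [h, ← two_mul, smul_eq_C_mul, ← mul_assoc]
  rw [show (2 : PolyH n) = C 2 from rfl, ← C_mul]
  norm_num

/-- The operator `∑ x_{αβ} ∘ W_{αβ}(∂)`. -/
noncomputable def weyl :
    Matrix (Fin n) (Fin n) (PolyH n) →ₗ[ℝ] Module.End ℝ (PolyH n) where
  toFun W := ∑ α, ∑ β, LinearMap.mulLeft ℝ (xv α β) ∘ₗ symb (W α β)
  map_add' W W' := by
    simp only [Matrix.add_apply, map_add, LinearMap.comp_add, sum_add_distrib]
  map_smul' r W := by
    simp only [Matrix.smul_apply, map_smul, LinearMap.comp_smul, smul_sum, RingHom.id_apply]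

lemma weyl_apply (W : Matrix (Fin n) (Fin n) (PolyH n)) (p : PolyH n) :
    weyl W p = ∑ α, ∑ β, xv α β * symb (W α β) p := by
  simp [weyl, LinearMap.sum_apply]

lemma weyl_weyl (W W' : Matrix (Fin n) (Fin n) (PolyH n)) (p : PolyH n) :
    weyl W (weyl W' p) = (∑ α, ∑ β, ∑ γ, ∑ δ, xv α β * (xv γ δ * symb (W α β * W' γ δ) p))
      + (2 : ℝ) • weyl (W.map (vecField W')) p := by
  rw [weyl_apply, weyl_apply W', weyl_apply]
  simp only [map_sum, symb_xv_mul, mul_sum, smul_sum, ← symb_mul_apply, mul_add,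
    sum_add_distrib, Matrix.map_apply, vecField_apply, map_smul, LinearMap.smul_apply,
    mul_smul_comm, LinearMap.sum_apply]
  simp only [smul_smul]
  norm_num
  simp only [← symb_mul_apply, mul_comm]

lemma weyl_commutator (W W' : Matrix (Fin n) (Fin n) (PolyH n)) (p : PolyH n) :
    weyl W (weyl W' p) - weyl W' (weyl W p)
      = (2 : ℝ) • weyl (W.map (vecField W') - W'.map (vecField W)) p := by
  have h : ∑ α, ∑ β, ∑ γ, ∑ δ, xv α β * (xv γ δ * symb (W α β * W' γ δ) p)
      = ∑ α, ∑ β, ∑ γ, ∑ δ, xv α β * (xv γ δ * symb (W' α β * W γ δ) p) := by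
    have h := Finset.sum_comm (s := univ) (t := univ)
      (f := fun q r : Fin n × Fin n => xv q.1 q.2 * (xv r.1 r.2 * symb (W q.1 q.2 * W' r.1 r.2) p))
    simp only [Fintype.sum_prod_type] at h
    rw [h]
    simp only [mul_comm, mul_left_comm]
  rw [weyl_weyl, weyl_weyl, h, map_sub, LinearMap.sub_apply, smul_sub]
  abel

lemma vecField_lie (W Y Z : Matrix (Fin n) (Fin n) (PolyH n)) :
    ⁅Y, Z⁆.map (vecField W) = ⁅Y.map (vecField W), Z⁆ + ⁅Y, Z.map (vecField W)⁆ := by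
  ext i j : 1
  simp only [Ring.lie_def, Matrix.map_apply, Matrix.sub_apply, Matrix.add_apply, Matrix.mul_apply,
    map_sub, map_sum, Derivation.leibniz, smul_eq_mul, sum_add_distrib]
  simp only [mul_comm]
  ring

end Operators

section Lorentz

open Finset

variable {n : ℕ}

noncomputable instance : LieRing (Matrix (Fin n) (Fin n) (PolyH n)) :=
  LieRing.ofAssociativeRing

noncomputable instance : LieAlgebra ℝ (Matrix (Fin n) (Fin n) (PolyH n)) :=
  LieAlgebra.ofAssociativeAlgebra

/-- The metric as a matrix of constant polynomials. -/
noncomputable def etaMat (n : ℕ) : Matrix (Fin n) (Fin n) (PolyH n) :=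
  Matrix.diagonal fun i => C (etaM i i)

/-- The antisymmetric matrix of variables. -/
noncomputable def xvMat (n : ℕ) : Matrix (Fin n) (Fin n) (PolyH n) := Matrix.of xv

/-- The generic element of the Lorentz algebra. -/
noncomputable def generic (n : ℕ) : Matrix (Fin n) (Fin n) (PolyH n) := xvMat n * etaMat n

/-- Half of the standard generator of the Lorentz algebra. -/
noncomputable def halfGen (μ ν : Fin n) : Matrix (Fin n) (Fin n) (PolyH n) :=
  (1 / 2 : ℝ) • ((Matrix.single μ ν 1 - Matrix.single ν μ 1) * etaMat n)

lemma etaM_mul_self (i : Fin n) : etaM i i * etaM i i = 1 := by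
  unfold etaM
  split_ifs <;> simp_all

lemma etaM_comm (i j : Fin n) : etaM i j = etaM j i := by
  unfold etaM
  by_cases h : i = j
  · rw [h]
  · simp [h, Ne.symm h]

lemma etaM_of_ne {i j : Fin n} (h : i ≠ j) : etaM i j = 0 := by
  simp [etaM, h]

@[simp] lemma etaMat_mul_self : etaMat n * etaMat n = 1 := by
  rw [etaMat, Matrix.diagonal_mul_diagonal, ← Matrix.diagonal_one]
  simp only [← C_mul, etaM_mul_self, C_1]

@[simp] lemma etaMat_transpose : (etaMat n).transpose = etaMat n := Matrix.diagonal_transpose _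

lemma xvMat_transpose : (xvMat n).transpose = - xvMat n := by
  ext i j : 1
  exact xv_swap i j

lemma etaMat_apply (i j : Fin n) : etaMat n i j = C (etaM i j) := by
  by_cases h : i = j
  · simp [etaMat, h]
  · simp [etaMat, h, etaM_of_ne h]

lemma single_mul_etaMat_mul_single (i μ ν ρ : Fin n) :
    Matrix.single i μ (1 : PolyH n) * etaMat n * Matrix.single ν ρ 1
      = etaM μ ν • Matrix.single i ρ 1 := by
  rw [Matrix.single_mul_mul_single, etaMat_apply, Matrix.smul_single, one_mul, mul_one,
    smul_eq_C_mul, mul_one]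

/-- A matrix `Y` lies in the orthogonal Lie algebra of the metric. -/
def IsEtaSkew (Y : Matrix (Fin n) (Fin n) (PolyH n)) : Prop :=
  (Y * etaMat n).transpose = - (Y * etaMat n)

lemma isEtaSkew_halfGen (μ ν : Fin n) : IsEtaSkew (halfGen μ ν) := by
  rw [IsEtaSkew, halfGen, Matrix.smul_mul, Matrix.mul_assoc, etaMat_mul_self, mul_one,
    Matrix.transpose_smul, Matrix.transpose_sub, Matrix.transpose_single, Matrix.transpose_single,
    ← smul_neg, neg_sub]

lemma transpose_lie_mul {R : Type*} [CommRing R] {x e Y : Matrix (Fin n) (Fin n) R}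
    (he : e * e = 1) (he' : e.transpose = e) (hx : x.transpose = -x)
    (hY : (Y * e).transpose = -(Y * e)) :
    (⁅x * e, Y⁆ * e).transpose = -(⁅x * e, Y⁆ * e) := by
  have h : ⁅x * e, Y⁆ * e = x * e * (Y * e) - Y * e * (e * x) := by
    rw [Ring.lie_def, sub_mul, Matrix.mul_assoc (x * e), Matrix.mul_assoc Y e,
      ← Matrix.mul_assoc e e, he, one_mul, Matrix.mul_assoc Y, Matrix.mul_assoc x e e, he, mul_one]
  rw [h, Matrix.transpose_sub, Matrix.transpose_mul (x * e), Matrix.transpose_mul x,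
    Matrix.transpose_mul (Y * e), hY, Matrix.transpose_mul e, he', hx]
  noncomm_ring

lemma IsEtaSkew.generic_lie {Y : Matrix (Fin n) (Fin n) (PolyH n)} (hY : IsEtaSkew Y) :
    IsEtaSkew ⁅generic n, Y⁆ :=
  transpose_lie_mul etaMat_mul_self etaMat_transpose xvMat_transpose hY

lemma isEtaSkew_adPow (μ ν : Fin n) (k : ℕ) : IsEtaSkew (adPow (generic n) k (halfGen μ ν)) := by
  induction k with
  | zero => simpa using isEtaSkew_halfGen μ ν
  | succ k ih => rw [adPow_succ]; exact ih.generic_lie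

lemma map_etaMat (d : Derivation ℝ (PolyH n) (PolyH n)) (Y : Matrix (Fin n) (Fin n) (PolyH n)) :
    (Y * etaMat n).map d = Y.map d * etaMat n := by
  ext i j : 1
  simp [etaMat, Matrix.mul_diagonal, mul_comm _ (C _), ← smul_eq_C_mul]

lemma map_generic {Y : Matrix (Fin n) (Fin n) (PolyH n)} (hY : IsEtaSkew Y) :
    (generic n).map (vecField (Y * etaMat n)) = Y := by
  rw [generic, map_etaMat]
  have h : (xvMat n).map (vecField (Y * etaMat n)) = Y * etaMat n := by
    ext i j : 1
    exact vecField_xv hY i j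
  rw [h, mul_assoc, etaMat_mul_self, mul_one]

lemma map_halfGen (d : Derivation ℝ (PolyH n) (PolyH n)) (μ ν : Fin n) :
    (halfGen μ ν).map d = 0 := by
  have h : (Matrix.single μ ν 1 - Matrix.single ν μ 1 : Matrix (Fin n) (Fin n) (PolyH n)).map d
      = 0 := by
    ext i j : 1
    simp [Matrix.single_apply, apply_ite d]
  rw [halfGen, ← Matrix.smul_mul, map_etaMat]
  have h' : ((1 / 2 : ℝ) • (Matrix.single μ ν 1 - Matrix.single ν μ 1 :
      Matrix (Fin n) (Fin n) (PolyH n))).map d = 0 := by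
    rw [Matrix.map_smul _ _ (fun a => d.map_smul _ a), h, smul_zero]
  rw [h', zero_mul]

lemma two_smul_lie_halfGen (μ ν lam ρ : Fin n) :
    (2 : ℝ) • ⁅halfGen μ ν, halfGen lam ρ⁆ = etaM ν lam • halfGen μ ρ - etaM μ lam • halfGen ν ρ
      - etaM ν ρ • halfGen μ lam + etaM μ ρ • halfGen ν lam := by
  simp only [halfGen, Ring.lie_def, Matrix.smul_mul, Matrix.mul_smul, sub_mul, mul_sub,
    ← mul_assoc, single_mul_etaMat_mul_single, smul_sub]
  simp only [etaM_comm lam, etaM_comm ρ]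
  module

lemma todd_weyl_commutator (μ ν lam ρ : Fin n) (m : ℕ) (p : PolyH n) :
    ∑ q ∈ antidiagonal (m + 1), ((todd q.1 * todd q.2 : ℚ) : ℝ) •
      (weyl (adPow (generic n) q.1 (halfGen μ ν) * etaMat n)
          (weyl (adPow (generic n) q.2 (halfGen lam ρ) * etaMat n) p)
        - weyl (adPow (generic n) q.2 (halfGen lam ρ) * etaMat n)
          (weyl (adPow (generic n) q.1 (halfGen μ ν) * etaMat n) p))
      = (todd m : ℝ) • weyl (adPow (generic n) m
          (etaM ν lam • halfGen μ ρ - etaM μ lam • halfGen ν ρ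
            - etaM ν ρ • halfGen μ lam + etaM μ ρ • halfGen ν lam) * etaMat n) p := by
  have h := sum_todd_derivation (generic n) (halfGen μ ν) (halfGen lam ρ)
    (fun l Y => Y.map (vecField (adPow (generic n) l (halfGen μ ν) * etaMat n)))
    (fun l Y => Y.map (vecField (adPow (generic n) l (halfGen lam ρ) * etaMat n)))
    (fun l => vecField_lie _) (fun l => vecField_lie _)
    (fun l => map_generic (isEtaSkew_adPow _ _ _)) (fun l => map_generic (isEtaSkew_adPow _ _ _))
    (fun l => map_halfGen _ _ _) (fun l => map_halfGen _ _ _) m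
  have h' := congrArg (fun Y => (2 : ℝ) • weyl (Y * etaMat n) p) h
  simp only [sum_mul, map_sum, LinearMap.sum_apply, smul_sum, Matrix.smul_mul, map_smul,
    LinearMap.smul_apply] at h'
  rw [← two_smul_lie_halfGen, map_smul, Matrix.smul_mul, map_smul, LinearMap.smul_apply,
    smul_comm, ← h']
  refine sum_congr rfl fun q _ => ?_
  rw [weyl_commutator, map_etaMat, map_etaMat, ← sub_mul, smul_comm]

end Lorentz

section Realization

open Finset

variable {n : ℕ}

lemma sum_etaM_smul {M : Type*} [AddCommGroup M] [Module ℝ M] (f : Fin n → Fin n → M)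
    (i j : Fin n) :
    ∑ k, ∑ l, (etaM i k * etaM j l) • f k l = (etaM i i * etaM j j) • f i j := by
  rw [sum_eq_single i (fun k _ hk => by simp [etaM_of_ne hk.symm]) (by simp),
    sum_eq_single j (fun l _ hl => by simp [etaM_of_ne hl.symm]) (by simp)]

/-- The derivation `∂_{μν}` as a polynomial in the partial derivatives. -/
noncomputable def dopSymb (μ ν : Fin n) : PolyH n := (etaM μ μ * etaM ν ν) • xv μ ν

/-- The operator `K` as a polynomial in the partial derivatives. -/
noncomputable def KopSymb (μ ν α β : Fin n) : PolyH n :=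
  (1 / 2 : ℝ) • (etaM μ α • dopSymb ν β - etaM μ β • dopSymb ν α
    + etaM ν β • dopSymb μ α - etaM ν α • dopSymb μ β)

lemma KopL_eq (μ ν α β : Fin n) (p : PolyH n) : KopL μ ν α β p = symb (KopSymb μ ν α β) p := by
  simp only [KopL, KopSymb, dopL_eq, dopSymb, map_smul, map_add, map_sub, LinearMap.smul_apply,
    LinearMap.add_apply, LinearMap.sub_apply]

lemma halfGen_apply (μ ν i j : Fin n) :
    halfGen μ ν i j = (1 / 2 * etaM j j : ℝ) • ((if μ = i then if ν = j then 1 else 0 else 0)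
      - (if ν = i then if μ = j then 1 else 0 else 0)) := by
  rw [halfGen, Matrix.smul_apply, etaMat, Matrix.mul_diagonal, mul_comm, ← smul_eq_C_mul,
    smul_smul, Matrix.sub_apply, Matrix.single_apply, Matrix.single_apply, ite_and, ite_and]

lemma generic_apply (i j : Fin n) : generic n i j = etaM j j • xv i j := by
  rw [generic, etaMat, Matrix.mul_diagonal, mul_comm, ← smul_eq_C_mul]
  rfl

lemma etaM_eq_ite (i j : Fin n) : etaM i j = if i = j then etaM j j else 0 := by
  by_cases h : i = j
  · simp [h]
  · simp [h, etaM_of_ne h]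

lemma sum_KopSymb_smul_halfGen (μ ν : Fin n) :
    ∑ lam, ∑ ρ, (etaM lam lam * etaM ρ ρ) • KopSymb μ ν lam ρ • halfGen lam ρ
      = - ⁅generic n, halfGen μ ν⁆ := by
  ext i j : 1
  have hl : (∑ lam, ∑ ρ, (etaM lam lam * etaM ρ ρ) • KopSymb μ ν lam ρ • halfGen lam ρ) i j
      = (1 / 2 * etaM i i : ℝ) • (KopSymb μ ν i j - KopSymb μ ν j i) := by
    simp only [Matrix.sum_apply, Matrix.smul_apply, halfGen_apply, smul_eq_mul, smul_sub, mul_sub,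
      sum_sub_distrib, smul_ite, smul_zero, mul_ite, mul_zero]
    simp [smul_smul]
    have := etaM_mul_self j
    congr 2 <;> linear_combination (1 / 2 * etaM i i) * this
  have hr : (- ⁅generic n, halfGen μ ν⁆) i j =
      (1 / 2 : ℝ) • ((if μ = i then (etaM ν ν * etaM j j) • xv ν j else 0)
        - (if ν = i then (etaM μ μ * etaM j j) • xv μ j else 0)
        + (if ν = j then (etaM μ μ * etaM j j) • xv μ i else 0)
        - (if μ = j then (etaM ν ν * etaM j j) • xv ν i else 0)) := by
    simp only [Ring.lie_def, Matrix.neg_apply, Matrix.sub_apply, Matrix.mul_apply, halfGen_apply,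
      generic_apply]
    simp [sub_mul, mul_sub, smul_sub]
    rw [xv_swap μ i, xv_swap ν i]
    split_ifs <;> module
  rw [hl, hr]
  simp only [KopSymb, dopSymb]
  rw [etaM_eq_ite μ i, etaM_eq_ite μ j, etaM_eq_ite ν i, etaM_eq_ite ν j]
  simp only [ite_smul, zero_smul]
  have := etaM_mul_self i
  split_ifs <;> match_scalars <;> grind

lemma adPow_poly_smul (k : ℕ) (c : PolyH n) (Y : Matrix (Fin n) (Fin n) (PolyH n)) :
    adPow (generic n) k (c • Y) = c • adPow (generic n) k Y := by
  induction k with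
  | zero => simp
  | succ k ih =>
    rw [adPow_succ, adPow_succ, ih, Ring.lie_def, Ring.lie_def, Matrix.mul_smul, Matrix.smul_mul,
      smul_sub]

lemma adPow_succ' (Y : Matrix (Fin n) (Fin n) (PolyH n)) (k : ℕ) :
    adPow (generic n) (k + 1) Y = adPow (generic n) k ⁅generic n, Y⁆ := by
  simp [adPow, pow_succ]

lemma KpowL_eq (m : ℕ) (μ ν α β : Fin n) (p : PolyH n) :
    KpowL m μ ν α β p
      = (-1 : ℝ) ^ m • symb ((etaMat n * adPow (generic n) m (halfGen μ ν)) α β) p := by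
  induction m generalizing μ ν p with
  | zero =>
    change ((1 / 2 : ℝ) * (etaM μ α * etaM ν β - etaM μ β * etaM ν α)) • p = _
    rw [pow_zero, one_smul, adPow_zero, etaMat, Matrix.diagonal_mul, halfGen_apply,
      ← smul_eq_C_mul, smul_smul, etaM_eq_ite μ, etaM_eq_ite ν, etaM_eq_ite μ, etaM_eq_ite ν]
    split_ifs <;> simp only [mul_sub, sub_smul, sub_self, sub_zero, zero_sub, smul_neg,
      map_neg, mul_zero, zero_mul, smul_zero, map_zero, LinearMap.zero_apply, LinearMap.neg_apply,
      map_smul, map_one, Module.End.one_apply, LinearMap.smul_apply] <;> module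
  | succ m ih =>
    have h : ∑ lam, ∑ ρ, (etaM lam lam * etaM ρ ρ) •
        (KopSymb μ ν lam ρ * (etaMat n * adPow (generic n) m (halfGen lam ρ)) α β)
        = - (etaMat n * adPow (generic n) (m + 1) (halfGen μ ν)) α β := by
      rw [adPow_succ', ← neg_neg ⁅generic n, halfGen μ ν⁆, ← sum_KopSymb_smul_halfGen]
      simp only [map_neg, map_sum, map_smul, adPow_poly_smul, mul_neg, Finset.mul_sum,
        Matrix.mul_smul, Matrix.neg_apply, Matrix.sum_apply, Matrix.smul_apply, neg_neg,
        smul_eq_mul]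
    calc KpowL (m + 1) μ ν α β p
        = (-1 : ℝ) ^ m • symb (∑ lam, ∑ ρ, (etaM lam lam * etaM ρ ρ) •
            (KopSymb μ ν lam ρ * (etaMat n * adPow (generic n) m (halfGen lam ρ)) α β)) p := by
          simp only [KpowL, sum_etaM_smul, KopL_eq, ih, map_sum, map_smul, symb_mul_apply,
            LinearMap.sum_apply, LinearMap.smul_apply, smul_sum]
          simp only [smul_comm ((-1 : ℝ) ^ m)]
      _ = _ := by rw [h, map_neg, LinearMap.neg_apply, pow_succ, mul_neg_one, neg_smul, smul_neg]

lemma bcoef_eq (k : ℕ) : bcoef k = (-1) ^ k * (todd k : ℝ) := by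
  rw [bcoef, todd]
  push_cast
  ring

/-- A matrix all of whose entries are homogeneous of degree `k`. -/
def IsHomogeneousMat (k : ℕ) (W : Matrix (Fin n) (Fin n) (PolyH n)) : Prop :=
  ∀ i j, (W i j).IsHomogeneous k

lemma IsHomogeneousMat.mul {k l : ℕ} {W W' : Matrix (Fin n) (Fin n) (PolyH n)}
    (h : IsHomogeneousMat k W) (h' : IsHomogeneousMat l W') : IsHomogeneousMat (k + l) (W * W') :=
  fun i j => by
    rw [Matrix.mul_apply]
    exact IsHomogeneous.sum _ _ _ fun a _ => (h i a).mul (h' a j)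

lemma isHomogeneousMat_etaMat : IsHomogeneousMat 0 (etaMat n) := fun i j => by
  rw [etaMat_apply]
  exact isHomogeneous_C _ _

lemma isHomogeneous_xv (i j : Fin n) : (xv i j).IsHomogeneous 1 := by
  unfold xv
  split_ifs
  · exact isHomogeneous_X _ _
  · exact (isHomogeneous_X _ _).neg
  · exact isHomogeneous_zero _ _ _

lemma isHomogeneousMat_halfGen (μ ν : Fin n) : IsHomogeneousMat 0 (halfGen μ ν) := fun i j => by
  rw [halfGen_apply]
  rw [← mem_homogeneousSubmodule]
  refine Submodule.smul_mem _ _ (Submodule.sub_mem _ ?_ ?_) <;> split_ifs <;>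
    first | exact isHomogeneous_one _ _ | exact isHomogeneous_zero _ _ _

lemma isHomogeneousMat_adPow (μ ν : Fin n) (k : ℕ) :
    IsHomogeneousMat k (adPow (generic n) k (halfGen μ ν)) := by
  induction k with
  | zero => simpa using isHomogeneousMat_halfGen μ ν
  | succ k ih =>
    have h : IsHomogeneousMat 1 (generic n) :=
      IsHomogeneousMat.mul (W := xvMat n) (isHomogeneous_xv) isHomogeneousMat_etaMat
    rw [adPow_succ, Ring.lie_def]
    exact fun i j => ((add_comm 1 k ▸ h.mul ih) i j).sub ((ih.mul h) i j)

lemma isHomogeneousMat_adPow_mul (μ ν : Fin n) (k : ℕ) :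
    IsHomogeneousMat k (adPow (generic n) k (halfGen μ ν) * etaMat n) :=
  (isHomogeneousMat_adPow μ ν k).mul isHomogeneousMat_etaMat

lemma xv_mul_mem_killedBy {d : ℕ} {p : PolyH n} (i j : Fin n) (hp : p ∈ killedBy d) :
    xv i j * p ∈ killedBy (d + 1) := by
  unfold xv
  split_ifs
  · exact X_mul_mem_killedBy _ hp
  · rw [neg_mul]
    exact neg_mem (X_mul_mem_killedBy _ hp)
  · rw [zero_mul]
    exact zero_mem _

lemma weyl_eq_zero {d k : ℕ} {W : Matrix (Fin n) (Fin n) (PolyH n)} (hW : IsHomogeneousMat k W)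
    {p : PolyH n} (hp : p ∈ killedBy d) (h : d ≤ k) : weyl W p = 0 := by
  rw [weyl_apply]
  exact sum_eq_zero fun i _ => sum_eq_zero fun j _ => by rw [hp k h _ (hW i j), mul_zero]

lemma weyl_mem_killedBy {d e k : ℕ} {W : Matrix (Fin n) (Fin n) (PolyH n)}
    (hW : IsHomogeneousMat k W) {p : PolyH n} (hp : p ∈ killedBy d) (h : d ≤ k + e) :
    weyl W p ∈ killedBy (e + 1) := by
  rw [weyl_apply]
  exact sum_mem fun i _ => sum_mem fun j _ =>
    xv_mul_mem_killedBy i j (symb_mem_killedBy (hW i j) hp h)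

lemma MhatL_eq (μ ν : Fin n) {d N : ℕ} {p : PolyH n} (hp : p ∈ killedBy d) (h : d ≤ N) :
    MhatL μ ν p = ∑ k ∈ range N,
      (todd k : ℝ) • weyl (adPow (generic n) k (halfGen μ ν) * etaMat n) p := by
  have hK : ∀ k α β, bcoef k • KpowL k μ ν α β p
      = (todd k : ℝ) • symb ((etaMat n * adPow (generic n) k (halfGen μ ν)) α β) p := by
    intro k α β
    rw [KpowL_eq, bcoef_eq, smul_smul, mul_right_comm, ← mul_pow]
    norm_num
  have hpsi : ∀ α β, psiKL μ ν α β p = ∑ k ∈ range N,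
      (todd k : ℝ) • symb ((etaMat n * adPow (generic n) k (halfGen μ ν)) α β) p := by
    intro α β
    simp only [psiKL, hK]
    refine finsum_eq_sum_of_support_subset _ fun k hk => ?_
    rw [coe_range, Set.mem_Iio]
    by_contra! hkN
    refine hk ?_
    have hom : IsHomogeneousMat (0 + k) (etaMat n * adPow (generic n) k (halfGen μ ν)) :=
      isHomogeneousMat_etaMat.mul (isHomogeneousMat_adPow μ ν k)
    rw [zero_add] at hom
    simp only [hp k (h.trans hkN) _ (hom α β), smul_zero]
  have heta : ∀ (Y : Matrix (Fin n) (Fin n) (PolyH n)) α β,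
      (Y * etaMat n) α β = (etaM α α * etaM β β) • (etaMat n * Y) α β := by
    intro Y α β
    rw [etaMat, Matrix.mul_diagonal, Matrix.diagonal_mul, ← smul_eq_C_mul, smul_smul,
      mul_right_comm, etaM_mul_self, one_mul, mul_comm, smul_eq_C_mul]
  simp only [MhatL, sum_etaM_smul, hpsi]
  simp only [weyl_apply, heta, map_smul, LinearMap.smul_apply, mul_sum, smul_sum, mul_smul_comm]
  rw [sum_comm (s := range N)]
  refine sum_congr rfl fun i _ => ?_
  rw [sum_comm (s := range N)]
  simp only [smul_comm (_ * _ : ℝ)]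

lemma MhatL_mem_killedBy (μ ν : Fin n) {d : ℕ} {p : PolyH n} (hp : p ∈ killedBy d) :
    MhatL μ ν p ∈ killedBy (d + 1) := by
  rw [MhatL_eq μ ν hp le_rfl]
  exact sum_mem fun k _ => Submodule.smul_mem _ _
    (weyl_mem_killedBy (isHomogeneousMat_adPow_mul μ ν k) hp (by lia))

lemma MhatL_MhatL (μ ν lam ρ : Fin n) {d : ℕ} {p : PolyH n} (hp : p ∈ killedBy d) :
    MhatL μ ν (MhatL lam ρ p) = ∑ k ∈ range (d + 1), ∑ l ∈ range (d + 1),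
      ((todd k * todd l : ℚ) : ℝ) • weyl (adPow (generic n) k (halfGen μ ν) * etaMat n)
        (weyl (adPow (generic n) l (halfGen lam ρ) * etaMat n) p) := by
  rw [MhatL_eq μ ν (MhatL_mem_killedBy lam ρ hp) le_rfl, MhatL_eq lam ρ hp (Nat.le_succ d)]
  simp only [map_sum, map_smul, smul_sum, smul_smul, Rat.cast_mul]

lemma weyl_weyl_eq_zero (μ ν lam ρ : Fin n) {d k l : ℕ} (h : d + 1 ≤ k + l) {p : PolyH n}
    (hp : p ∈ killedBy d) :
    weyl (adPow (generic n) k (halfGen μ ν) * etaMat n)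
      (weyl (adPow (generic n) l (halfGen lam ρ) * etaMat n) p) = 0 := by
  rcases le_or_gt d l with hl | hl
  · rw [weyl_eq_zero (isHomogeneousMat_adPow_mul lam ρ l) hp hl, map_zero]
  · exact weyl_eq_zero (isHomogeneousMat_adPow_mul μ ν k)
      (weyl_mem_killedBy (e := d - l) (isHomogeneousMat_adPow_mul lam ρ l) hp (by lia)) (by lia)

lemma sum_range_sum_range_eq_sum_antidiagonal {M : Type*} [AddCommMonoid M] (f : ℕ → ℕ → M)
    (N : ℕ) (hf : ∀ k l, N ≤ k + l → f k l = 0) :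
    ∑ k ∈ range N, ∑ l ∈ range N, f k l = ∑ s ∈ range N, ∑ q ∈ antidiagonal s, f q.1 q.2 := by
  rw [← sum_product', ← sum_filter_of_ne (p := fun q : ℕ × ℕ => q.1 + q.2 < N),
    ← sum_fiberwise_of_maps_to (g := fun q : ℕ × ℕ => q.1 + q.2) (t := range N)]
  · refine sum_congr rfl fun s hs => sum_congr ?_ fun _ _ => rfl
    ext q
    simp only [mem_filter, mem_product, mem_range, HasAntidiagonal.mem_antidiagonal] at hs ⊢
    lia
  · simp +contextual
  · intro q _ hq
    by_contra! h
    exact hq (hf _ _ h)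

lemma MhatL_commutator (μ ν lam ρ : Fin n) {d : ℕ} {p : PolyH n} (hp : p ∈ killedBy d) :
    MhatL μ ν (MhatL lam ρ p) - MhatL lam ρ (MhatL μ ν p)
      = ∑ m ∈ range d, (todd m : ℝ) • weyl (adPow (generic n) m
          (etaM ν lam • halfGen μ ρ - etaM μ lam • halfGen ν ρ
            - etaM ν ρ • halfGen μ lam + etaM μ ρ • halfGen ν lam) * etaMat n) p := by
  rw [MhatL_MhatL μ ν lam ρ hp, MhatL_MhatL lam ρ μ ν hp, sum_comm (s := range (d + 1))
    (f := fun k l => ((todd k * todd l : ℚ) : ℝ) •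
      weyl (adPow (generic n) k (halfGen lam ρ) * etaMat n)
        (weyl (adPow (generic n) l (halfGen μ ν) * etaMat n) p)), ← sum_sub_distrib]
  simp only [← sum_sub_distrib, mul_comm (todd _) (todd _), ← smul_sub]
  rw [sum_range_sum_range_eq_sum_antidiagonal, sum_range_succ']
  · rw [← sum_congr rfl fun m _ => todd_weyl_commutator μ ν lam ρ m p,
      Finset.Nat.antidiagonal_zero, sum_singleton, adPow_zero, adPow_zero, weyl_commutator,
      map_etaMat, map_etaMat, map_halfGen, map_halfGen, sub_self, map_zero, LinearMap.zero_apply, smul_zero,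
      smul_zero, add_zero]
  · intro k l h
    rw [weyl_weyl_eq_zero μ ν lam ρ h hp, weyl_weyl_eq_zero lam ρ μ ν (add_comm k l ▸ h) hp,
      sub_zero, smul_zero]

end Realization

end WeylLorentz

open WeylLorentz

/-- Eq. (2.53): the operators `M̂_{μν}` satisfy the Lorentz algebra
`so(1,n-1)` commutation relations. -/
theorem statement14 (n : ℕ) (hn : 2 ≤ n) (μ ν lam ρ : Fin n) :
    MhatL μ ν ∘ MhatL lam ρ - MhatL lam ρ ∘ MhatL μ ν
      = etaM ν lam • MhatL μ ρ - etaM μ lam • MhatL ν ρ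
        - etaM ν ρ • MhatL μ lam + etaM μ ρ • MhatL ν lam := by
  funext p
  obtain ⟨d, hp⟩ := exists_mem_killedBy p
  simp only [Pi.sub_apply, Pi.add_apply, Pi.smul_apply, Function.comp_apply]
  rw [MhatL_commutator μ ν lam ρ hp, MhatL_eq μ ρ hp le_rfl, MhatL_eq ν ρ hp le_rfl,
    MhatL_eq μ lam hp le_rfl, MhatL_eq ν lam hp le_rfl]
  simp only [Finset.smul_sum, ← Finset.sum_sub_distrib, ← Finset.sum_add_distrib]
  refine Finset.sum_congr rfl fun m _ => ?_
  simp only [map_add, map_sub, map_smul, add_mul, sub_mul, Matrix.smul_mul, LinearMap.add_apply,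
    LinearMap.sub_apply, LinearMap.smul_apply]
  module
end

section
/- Let η = diag(-1,1,…,1). Let P = ℝ[x_{μν} : 1 ≤ μ < ν ≤ n] with x_{νμ} := -x_{μν}, multiplication operators x_{αβ}, and derivations ∂_{μν} satisfying [∂_{μν},x_{αβ}] = η_{μα}η_{νβ} - η_{μβ}η_{να}. Let M̂_{μν} = Σ_{α,β}Σ_{α',β'} x_{αβ} η_{αα'} η_{ββ'} ∘ ψ(K)_{(μν)(α'β')} be the Weyl realization of the Lorentz algebra (with K and its η-contracted powers as in the Lorentz setting), and define Λ̂_{μν} = (e^∂)_{μν}, where the η-contracted matrix powers are (∂⁰)_{μν} = η_{μν} and (∂^m)_{μν} = Σ_{α,β} (∂^{m-1})_{μα} η_{αβ} ∂_{βν}, and (e^∂)_{μν} = Σ_{m≥0}(1/m!)(∂^m)_{μν}. Then [M̂_{μν}, Λ̂_{ρσ}] = η_{νρ} Λ̂_{μσ} - η_{μρ} Λ̂_{νσ} and [Λ̂_{μν}, Λ̂_{ρσ}] = 0 for all indices. -/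
open MvPolynomial

/-- `η`-contracted matrix powers of `∂ = [∂_{μν}]`: `(∂⁰)_{μν} = η_{μν}`,
`(∂^m)_{μν} = Σ_{α,β}(∂^{m-1})_{μα} η_{αβ} ∂_{βν}`. -/
noncomputable def dmatpowL {n : ℕ} : ℕ → Fin n → Fin n → (PolyH n → PolyH n)
  | 0 => fun μ ν p => etaM μ ν • p
  | m+1 => fun μ ν p => ∑ α, ∑ β, etaM α β • dmatpowL m μ α (dopL β ν p)

/-- The quantum angles `Λ̂_{μν} = (e^∂)_{μν} = Σ_{m≥0}(1/m!)(∂^m)_{μν}`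
(`η`-contracted powers). -/
noncomputable def LhatL {n : ℕ} (μ ν : Fin n) : PolyH n → PolyH n := fun p =>
  ∑ᶠ m : ℕ, ((m.factorial : ℝ))⁻¹ • dmatpowL m μ ν p

section BernoulliIdentity

lemma bcoef_eq_bernoulli' (k : ℕ) :
    bcoef k = algebraMap ℚ ℝ (bernoulli' k / (k.factorial : ℚ)) := by
  simp [bcoef, bernoulli'_eq_bernoulli]

/-- The graded pieces of `ψ((b - a)t) (e^{bt} - e^{at}) = (b - a) t e^{bt}`. -/
lemma sum_bcoef_mul_pow_sub_pow {C : Type*} [CommRing C] [Algebra ℝ C] [Algebra ℚ C] (a b : C)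
    (N : ℕ) :
    ∑ x ∈ Finset.HasAntidiagonal.antidiagonal (N + 1),
      (bcoef x.1 * ((x.2.factorial : ℝ))⁻¹) • ((b - a) ^ x.1 * (b ^ x.2 - a ^ x.2))
      = ((N.factorial : ℝ))⁻¹ • ((b - a) * b ^ N) := by
  have h := congrArg (PowerSeries.rescale (b - a)) (bernoulli'PowerSeries_mul_exp_sub_one C)
  have h2 := PowerSeries.exp_mul_exp_eq_exp_add (A := C) (b - a) a
  rw [sub_add_cancel] at h2
  rw [map_mul, map_mul, map_sub, map_one] at h
  have h3 : PowerSeries.rescale (b - a) (bernoulli'PowerSeries C) *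
      (PowerSeries.rescale b (PowerSeries.exp C) - PowerSeries.rescale a (PowerSeries.exp C))
      = PowerSeries.X * (PowerSeries.C (b - a) * PowerSeries.rescale b (PowerSeries.exp C)) := by
    rw [← h2]
    have hX : PowerSeries.rescale (b - a) (PowerSeries.X : PowerSeries C)
        = PowerSeries.C (b - a) * PowerSeries.X := PowerSeries.rescale_X _
    rw [hX] at h
    linear_combination (PowerSeries.rescale a (PowerSeries.exp C)) * h
  have h4 := congrArg (PowerSeries.coeff (N + 1)) h3
  rw [PowerSeries.coeff_mul, PowerSeries.coeff_succ_X_mul, PowerSeries.coeff_C_mul] at h4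
  have key (q : ℚ) (c : C) : algebraMap ℚ C q * c = (algebraMap ℚ ℝ q) • c := by
    rw [Algebra.smul_def]
    exact congrArg (· * c) (RingHom.congr_fun (Subsingleton.elim (algebraMap ℚ C)
      ((algebraMap ℝ C).comp (algebraMap ℚ ℝ))) q)
  have inv_fact (j : ℕ) : algebraMap ℚ ℝ (1 / (j.factorial : ℚ)) = ((j.factorial : ℝ))⁻¹ := by simp
  simp only [PowerSeries.coeff_rescale, map_sub, PowerSeries.coeff_exp, bernoulli'PowerSeries,
    PowerSeries.coeff_mk] at h4
  calc _ = _ := Finset.sum_congr rfl fun x _ => ?_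
    _ = _ := h4
    _ = _ := ?_
  · rw [bcoef_eq_bernoulli', ← inv_fact, ← map_mul, ← key, map_mul]
    ring
  · rw [← inv_fact, ← key]
    ring

lemma sum_bcoef_mul_geom_sum₂ {C : Type*} [CommRing C] [IsDomain C] [Algebra ℝ C] [Algebra ℚ C]
    (a b : C) (hab : b ≠ a) (N : ℕ) :
    ∑ x ∈ Finset.HasAntidiagonal.antidiagonal (N + 1),
      (bcoef x.1 * ((x.2.factorial : ℝ))⁻¹) •
        ((∑ i ∈ Finset.range x.2, a ^ i * b ^ (x.2 - 1 - i)) * (b - a) ^ x.1)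
      = ((N.factorial : ℝ))⁻¹ • b ^ N := by
  apply mul_left_cancel₀ (sub_ne_zero.2 hab)
  rw [mul_smul_comm, ← sum_bcoef_mul_pow_sub_pow, Finset.mul_sum]
  refine Finset.sum_congr rfl fun x _ => ?_
  rw [mul_smul_comm]
  congr 1
  have h := geom_sum₂_mul a b x.2
  linear_combination -(b - a) ^ x.1 * h

/-- The same identity for two commuting elements of a noncommutative algebra. -/
lemma sum_bcoef_mul_geom_sum₂_of_commute {T : Type*} [Ring T] [Algebra ℝ T] (a b : T)
    (hab : Commute a b) (N : ℕ) :
    ∑ x ∈ Finset.HasAntidiagonal.antidiagonal (N + 1),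
      (bcoef x.1 * ((x.2.factorial : ℝ))⁻¹) •
        ((∑ i ∈ Finset.range x.2, a ^ i * b ^ (x.2 - 1 - i)) * (b - a) ^ x.1)
      = ((N.factorial : ℝ))⁻¹ • b ^ N := by
  let φ : Polynomial (Polynomial ℝ) →+* T :=
    Polynomial.eval₂RingHom' (Polynomial.aeval a : Polynomial ℝ →ₐ[ℝ] T).toRingHom b fun q => by
      induction q using Polynomial.induction_on' with
      | add p q hp hq => simpa using hp.add_left hq
      | monomial k r =>
        simpa [Polynomial.aeval_monomial] using
          (Algebra.commute_algebraMap_left r b).mul_left (hab.pow_left k)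
  have hφX : φ Polynomial.X = b := by simp [φ, Polynomial.eval₂RingHom']
  have hφC : φ (Polynomial.C Polynomial.X) = a := by simp [φ, Polynomial.eval₂RingHom']
  have hφsmul (r : ℝ) (p) : φ (r • p) = r • φ p := by
    have : r • p = Polynomial.C (Polynomial.C r) * p := by
      rw [Algebra.smul_def]; rfl
    rw [this, map_mul, Algebra.smul_def]
    congr 1
    simp [φ, Polynomial.eval₂RingHom']
  have hne : (Polynomial.X : Polynomial (Polynomial ℝ)) ≠ Polynomial.C Polynomial.X :=
    Polynomial.X_ne_C _
  have h := congrArg φ (sum_bcoef_mul_geom_sum₂ _ _ hne N)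
  simpa only [map_sum, hφsmul, map_mul, map_pow, map_sub, hφX, hφC] using h

/-- Right minus left multiplication by `D`. -/
noncomputable def rightSubLeft {T : Type*} [Ring T] [Algebra ℝ T] (D : T) : Module.End ℝ T :=
  LinearMap.mulRight ℝ D - LinearMap.mulLeft ℝ D

lemma rightSubLeft_apply {T : Type*} [Ring T] [Algebra ℝ T] (D F : T) :
    rightSubLeft D F = F * D - D * F := rfl

lemma sum_bcoef_smul_rightSubLeft {T : Type*} [Ring T] [Algebra ℝ T] (D F : T) (N : ℕ) :
    ∑ x ∈ Finset.HasAntidiagonal.antidiagonal (N + 1),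
      (bcoef x.1 * ((x.2.factorial : ℝ))⁻¹) •
        ∑ i ∈ Finset.range x.2, D ^ i * (rightSubLeft D ^ x.1) F * D ^ (x.2 - 1 - i)
      = ((N.factorial : ℝ))⁻¹ • (F * D ^ N) := by
  have h := LinearMap.congr_fun (sum_bcoef_mul_geom_sum₂_of_commute (LinearMap.mulLeft ℝ D)
    (LinearMap.mulRight ℝ D) (LinearMap.commute_mulLeft_right D D) N) F
  simpa [LinearMap.sum_apply, LinearMap.pow_mulLeft, LinearMap.pow_mulRight, rightSubLeft,
    mul_assoc] using h

end BernoulliIdentity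

section Commutators

lemma pow_mul_sub_mul_pow {T : Type*} [Ring T] (D x : T) (m : ℕ) :
    D ^ m * x - x * D ^ m
      = ∑ i ∈ Finset.range m, D ^ i * (D * x - x * D) * D ^ (m - 1 - i) := by
  induction m with
  | zero => simp
  | succ m ih =>
    have h : D ^ (m + 1) * x - x * D ^ (m + 1)
        = D * (D ^ m * x - x * D ^ m) + (D * x - x * D) * D ^ m := by
      rw [pow_succ']; noncomm_ring
    rw [h, ih, Finset.sum_range_succ', Finset.mul_sum]
    congr 1
    · refine Finset.sum_congr rfl fun i _ => ?_
      rw [pow_succ', show m + 1 - 1 - (i + 1) = m - 1 - i by omega]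
      simp only [mul_assoc]
    · simp

lemma rightSubLeft_pow_mul {T : Type*} [Ring T] [Algebra ℝ T] {D c : T} (h : Commute c D) (F : T)
    (k : ℕ) : (rightSubLeft D ^ k) (F * c) = (rightSubLeft D ^ k) F * c := by
  induction k with
  | zero => rfl
  | succ k ih =>
    rw [pow_succ', Module.End.mul_apply, Module.End.mul_apply, ih, rightSubLeft_apply,
      rightSubLeft_apply, mul_assoc, h.eq, sub_mul, mul_assoc, mul_assoc]

/-- The linear map `F ↦ Σ_i D^i F D^{m-1-i}`. -/
noncomputable def sandwichSum {T : Type*} [Ring T] [Algebra ℝ T] (D : T) (m : ℕ) :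
    Module.End ℝ T :=
  ∑ i ∈ Finset.range m, LinearMap.mulLeft ℝ (D ^ i) * LinearMap.mulRight ℝ (D ^ (m - 1 - i))

lemma sandwichSum_apply {T : Type*} [Ring T] [Algebra ℝ T] (D : T) (m : ℕ) (F : T) :
    sandwichSum D m F = ∑ i ∈ Finset.range m, D ^ i * F * D ^ (m - 1 - i) := by
  simp [sandwichSum, LinearMap.sum_apply, mul_assoc]

lemma rightSubLeft_mul_pow_apply {T : Type*} [Ring T] [Algebra ℝ T] {H D x c F : T}
    (hc : Commute c D) (hcH : Commute c H) (hxH : Commute x H) (hF : D * x - x * D = F) (m : ℕ) :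
    rightSubLeft (H * D ^ m) (x * c) = -(H * sandwichSum D m (F * c)) := by
  have h2 : x * c * (H * D ^ m) = H * (x * D ^ m) * c := by
    rw [mul_assoc, ← mul_assoc c, hcH.eq, mul_assoc H, (hc.pow_right m).eq, ← mul_assoc, hxH.eq]
    simp only [mul_assoc]
  have h3 : sandwichSum D m (F * c) = (D ^ m * x - x * D ^ m) * c := by
    rw [pow_mul_sub_mul_pow, hF, Finset.sum_mul, sandwichSum_apply]
    refine Finset.sum_congr rfl fun i _ => ?_
    simp only [mul_assoc, (hc.pow_right _).eq]
  rw [rightSubLeft_apply, h2, h3]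
  noncomm_ring

end Commutators

section Operators

variable {n : ℕ}

lemma etaM_self_mul_self (μ : Fin n) : etaM μ μ * etaM μ μ = 1 := by
  simp only [etaM]; split_ifs <;> norm_num

lemma etaM_of_ne {μ ν : Fin n} (h : μ ≠ ν) : etaM μ ν = 0 := if_neg h

lemma etaM_comm (μ ν : Fin n) : etaM μ ν = etaM ν μ := by
  by_cases h : μ = ν
  · rw [h]
  · rw [etaM_of_ne h, etaM_of_ne (Ne.symm h)]

lemma sum_etaM_smul {V : Type*} [AddCommGroup V] [Module ℝ V] (μ : Fin n) (f : Fin n → V) :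
    ∑ ν, etaM μ ν • f ν = etaM μ μ • f μ :=
  Finset.sum_eq_single_of_mem _ (Finset.mem_univ _) fun ν _ h => by
    rw [etaM_of_ne h.symm, zero_smul]

/-- Contraction of two pairs of indices with the Minkowski metric. -/
lemma sum_etaM_mul_etaM_smul {V : Type*} [AddCommGroup V] [Module ℝ V]
    (f : Fin n → Fin n → Fin n → Fin n → V) :
    ∑ α, ∑ β, ∑ α', ∑ β', (etaM α α' * etaM β β') • f α β α' β'
      = ∑ α, ∑ β, (etaM α α * etaM β β) • f α β α β := by
  refine Finset.sum_congr rfl fun α _ => Finset.sum_congr rfl fun β _ => ?_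
  simp only [mul_smul, ← Finset.smul_sum, sum_etaM_smul]

/-- The operators `∂_{μν}` as linear maps. -/
noncomputable def dLin (μ ν : Fin n) : Module.End ℝ (PolyH n) where
  toFun := dopL μ ν
  map_add' p q := by
    unfold dopL; split_ifs <;> simp only [map_add, smul_add, neg_add, add_zero]
  map_smul' r p := by
    unfold dopL; split_ifs <;> simp [smul_comm _ r]

lemma dLin_apply (μ ν : Fin n) (p : PolyH n) : dLin μ ν p = dopL μ ν p := rfl

lemma dLin_antisymm (μ ν : Fin n) : dLin ν μ = -dLin μ ν := by
  refine LinearMap.ext fun p => ?_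
  simp only [dLin_apply, LinearMap.neg_apply, dopL]
  rcases lt_trichotomy μ ν with h | h | h
  · simp [h, h.not_gt, mul_comm]
  · simp [h]
  · simp [h, h.not_gt, mul_comm]

lemma pderiv_comm {σ R : Type*} [CommSemiring R] (i j : σ) (p : MvPolynomial σ R) :
    pderiv i (pderiv j p) = pderiv j (pderiv i p) := by
  classical
  induction p using MvPolynomial.induction_on with
  | C a => simp
  | add p q hp hq => simp [hp, hq]
  | mul_X p k hp =>
    simp only [Derivation.leibniz, map_add, hp, smul_eq_mul, pderiv_X, Pi.single_apply]
    split_ifs <;> simp <;> ring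

lemma dLin_commute (μ ν α β : Fin n) : Commute (dLin μ ν) (dLin α β) := by
  refine LinearMap.ext fun p => ?_
  simp only [Module.End.mul_apply, dLin_apply, dopL]
  split_ifs <;> simp [smul_comm (etaM μ μ * etaM ν ν), pderiv_comm]

lemma dLin_C (μ ν : Fin n) (a : ℝ) : dLin μ ν (C a : PolyH n) = 0 := by
  simp only [dLin_apply, dopL]; split_ifs <;> simp

lemma dLin_mul (μ ν : Fin n) (p q : PolyH n) :
    dLin μ ν (p * q) = p * dLin μ ν q + dLin μ ν p * q := by
  simp only [dLin_apply, dopL]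
  split_ifs
  · simp only [Derivation.leibniz, smul_add, smul_eq_mul, smul_eq_C_mul]; ring
  · simp only [Derivation.leibniz, smul_add, smul_eq_mul, smul_eq_C_mul, neg_add,
      mul_neg, neg_mul]; ring
  · simp

/-- The canonical commutation relation `∂_{μν}(x_{αβ}) = η_{μα}η_{νβ} - η_{μβ}η_{να}`. -/
lemma dLin_xv (μ ν α β : Fin n) :
    dLin μ ν (xv α β : PolyH n) = C (etaM μ α * etaM ν β - etaM μ β * etaM ν α) := by
  have lt_case (μ ν α β : Fin n) (h : μ < ν) (h' : α < β) :
      dLin μ ν (xv α β : PolyH n) = C (etaM μ α * etaM ν β - etaM μ β * etaM ν α) := by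
    simp only [dLin_apply, dopL, xv, h, h', dif_pos, pderiv_X, Pi.single_apply, Subtype.mk.injEq,
      Prod.mk.injEq]
    have h0 : etaM μ β * etaM ν α = 0 := by
      by_cases h1 : μ = β
      · rw [etaM_of_ne (μ := ν) (ν := α) (by omega), mul_zero]
      · rw [etaM_of_ne h1, zero_mul]
    rw [h0, sub_zero]
    split_ifs with h1
    · rw [h1.1, h1.2, smul_eq_C_mul, mul_one]
    · rw [smul_zero]
      rcases not_and_or.1 h1 with h2 | h2
      · rw [etaM_of_ne (Ne.symm h2), zero_mul, C_0]
      · rw [etaM_of_ne (μ := ν) (Ne.symm h2), mul_zero, C_0]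
  have xv_antisymm (α β : Fin n) : (xv β α : PolyH n) = -xv α β := by
    simp only [xv]
    rcases lt_trichotomy α β with h | h | h
    · simp [h, h.not_gt]
    · simp [h]
    · simp [h, h.not_gt]
  have pos_case (μ ν α β : Fin n) (h : μ < ν) :
      dLin μ ν (xv α β : PolyH n) = C (etaM μ α * etaM ν β - etaM μ β * etaM ν α) := by
    rcases lt_trichotomy α β with h' | h' | h'
    · exact lt_case μ ν α β h h'
    · subst h'; simp [xv]
    · rw [xv_antisymm β α, map_neg, lt_case μ ν β α h h', ← C_neg]
      congr 1; ring
  rcases lt_trichotomy μ ν with h | h | h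
  · exact pos_case μ ν α β h
  · subst h
    rw [mul_comm, sub_self, C_0]
    simp [dLin_apply, dopL]
  · rw [dLin_antisymm ν μ, LinearMap.neg_apply, pos_case ν μ α β h, ← C_neg]
    congr 1; ring

/-- The polynomials killed by all products of `N` operators `∂_{μν}`. -/
noncomputable def derivKer (n : ℕ) : ℕ → Submodule ℝ (PolyH n)
  | 0 => ⊥
  | N + 1 => ⨅ μ, ⨅ ν, (derivKer n N).comap (dLin μ ν)

lemma mem_derivKer_succ {N : ℕ} {p : PolyH n} :
    p ∈ derivKer n (N + 1) ↔ ∀ μ ν, dLin μ ν p ∈ derivKer n N := by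
  simp [derivKer]

lemma derivKer_mono : Monotone (derivKer n) := by
  refine monotone_nat_of_le_succ fun N => ?_
  induction N with
  | zero => exact bot_le
  | succ N ih =>
    intro p hp
    rw [mem_derivKer_succ] at hp ⊢
    exact fun μ ν => ih (hp μ ν)

lemma xv_mul_mem_derivKer (α β : Fin n) {N : ℕ} {p : PolyH n} (hp : p ∈ derivKer n N) :
    xv α β * p ∈ derivKer n (N + 1) := by
  induction N generalizing p with
  | zero =>
    rw [(Submodule.mem_bot ℝ).1 hp, mul_zero]
    exact Submodule.zero_mem _
  | succ N ih =>
    rw [mem_derivKer_succ]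
    intro μ ν
    rw [dLin_mul, dLin_xv, ← smul_eq_C_mul]
    exact Submodule.add_mem _ (ih (mem_derivKer_succ.1 hp μ ν)) (Submodule.smul_mem _ _ hp)

lemma exists_mem_derivKer (p : PolyH n) : ∃ N, p ∈ derivKer n N := by
  induction p using MvPolynomial.induction_on with
  | C a =>
    refine ⟨1, mem_derivKer_succ.2 fun μ ν => ?_⟩
    rw [dLin_C]
    exact Submodule.zero_mem _
  | add p q hp hq =>
    obtain ⟨N, hN⟩ := hp
    obtain ⟨M, hM⟩ := hq
    exact ⟨max N M, Submodule.add_mem _ (derivKer_mono (le_max_left N M) hN)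
      (derivKer_mono (le_max_right N M) hM)⟩
  | mul_X p i hp =>
    obtain ⟨N, hN⟩ := hp
    refine ⟨N + 1, ?_⟩
    have := xv_mul_mem_derivKer i.1.1 i.1.2 hN
    rwa [xv, dif_pos i.2, mul_comm] at this

/-- The operators mapping each polynomial killed by all products of `N + k` operators `∂_{μν}` to
one killed by all products of `N` of them. -/
noncomputable def lowering (n k : ℕ) : Submodule ℝ (Module.End ℝ (PolyH n)) where
  carrier := {A | ∀ N, ∀ p ∈ derivKer n (N + k), A p ∈ derivKer n N}
  zero_mem' _ _ _ := Submodule.zero_mem _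
  add_mem' ha hb N p hp := Submodule.add_mem _ (ha N p hp) (hb N p hp)
  smul_mem' r _ ha N p hp := Submodule.smul_mem _ r (ha N p hp)

lemma mul_mem_lowering {k l : ℕ} {A B : Module.End ℝ (PolyH n)} (hA : A ∈ lowering n k)
    (hB : B ∈ lowering n l) : A * B ∈ lowering n (k + l) :=
  fun N p hp => hA N _ (hB (N + k) p (by rwa [add_assoc]))

lemma one_mem_lowering : (1 : Module.End ℝ (PolyH n)) ∈ lowering n 0 := fun _ _ hp => hp

lemma dLin_mem_lowering (μ ν : Fin n) : dLin μ ν ∈ lowering n 1 :=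
  fun _ _ hp => mem_derivKer_succ.1 hp μ ν

lemma apply_eq_zero_of_mem_lowering {k N : ℕ} {A : Module.End ℝ (PolyH n)}
    (hA : A ∈ lowering n k) (hN : N ≤ k) {p : PolyH n} (hp : p ∈ derivKer n N) : A p = 0 :=
  (Submodule.mem_bot ℝ).1 (hA 0 p (derivKer_mono (by omega) hp))

lemma apply_mem_derivKer_of_mem_lowering {k N : ℕ} {A : Module.End ℝ (PolyH n)}
    (hA : A ∈ lowering n k) {p : PolyH n} (hp : p ∈ derivKer n N) : A p ∈ derivKer n N :=
  hA N p (derivKer_mono (by omega) hp)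

lemma finsum_smul_apply_eq_sum {N : ℕ} (c : ℕ → ℝ) (A : ℕ → Module.End ℝ (PolyH n))
    (hA : ∀ k, A k ∈ lowering n k) {p : PolyH n} (hp : p ∈ derivKer n N) :
    ∑ᶠ k, c k • A k p = (∑ k ∈ Finset.range N, c k • A k) p := by
  rw [finsum_eq_sum_of_support_subset (s := Finset.range N)]
  · simp
  · intro k hk
    by_contra h
    refine hk ?_
    have : N ≤ k := by simpa using h
    simp only [apply_eq_zero_of_mem_lowering (hA k) this hp, smul_zero]

/-- The operators `K_{(μν)(αβ)}` as linear maps. -/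
noncomputable def kLin (μ ν α β : Fin n) : Module.End ℝ (PolyH n) :=
  (1 / 2 : ℝ) • (etaM μ α • dLin ν β - etaM μ β • dLin ν α
    + etaM ν β • dLin μ α - etaM ν α • dLin μ β)

/-- The `η`-contracted powers of `K` as linear maps. -/
noncomputable def kPowLin : ℕ → Fin n → Fin n → Fin n → Fin n → Module.End ℝ (PolyH n)
  | 0 => fun μ ν α β => ((1 / 2 : ℝ) * (etaM μ α * etaM ν β - etaM μ β * etaM ν α)) • 1
  | m + 1 => fun μ ν α β => ∑ lam, ∑ ρ,
      (etaM lam lam * etaM ρ ρ) • (kLin μ ν lam ρ * kPowLin m lam ρ α β)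

lemma kPowLin_apply (m : ℕ) (μ ν α β : Fin n) (p : PolyH n) :
    kPowLin m μ ν α β p = KpowL m μ ν α β p := by
  induction m generalizing μ ν with
  | zero => rfl
  | succ m ih =>
    simp only [KpowL]
    rw [sum_etaM_mul_etaM_smul fun lam ρ lam' ρ' => KopL μ ν lam ρ (KpowL m lam' ρ' α β p)]
    simp only [kPowLin, LinearMap.sum_apply, LinearMap.smul_apply, Module.End.mul_apply, ih]
    rfl

lemma kLin_mem_lowering (μ ν α β : Fin n) : kLin μ ν α β ∈ lowering n 1 :=
  Submodule.smul_mem _ _ <| Submodule.sub_mem _ (Submodule.add_mem _ (Submodule.sub_mem _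
    (Submodule.smul_mem _ _ (dLin_mem_lowering _ _))
    (Submodule.smul_mem _ _ (dLin_mem_lowering _ _)))
    (Submodule.smul_mem _ _ (dLin_mem_lowering _ _)))
    (Submodule.smul_mem _ _ (dLin_mem_lowering _ _))

lemma kPowLin_mem_lowering (m : ℕ) (μ ν α β : Fin n) : kPowLin m μ ν α β ∈ lowering n m := by
  induction m generalizing μ ν with
  | zero => exact Submodule.smul_mem _ _ one_mem_lowering
  | succ m ih =>
    refine Submodule.sum_mem _ fun lam _ => Submodule.sum_mem _ fun ρ _ =>
      Submodule.smul_mem _ _ ?_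
    rw [add_comm]
    exact mul_mem_lowering (kLin_mem_lowering _ _ _ _) (ih _ _)

lemma commute_kLin {A : Module.End ℝ (PolyH n)} (hA : ∀ μ ν, Commute A (dLin μ ν))
    (μ ν α β : Fin n) : Commute A (kLin μ ν α β) := by
  have h (r : ℝ) (γ δ : Fin n) : Commute A (r • dLin γ δ) := (hA γ δ).smul_right r
  exact ((((h _ _ _).sub_right (h _ _ _)).add_right (h _ _ _)).sub_right (h _ _ _)).smul_right _

lemma commute_kPowLin {A : Module.End ℝ (PolyH n)} (hA : ∀ μ ν, Commute A (dLin μ ν)) (m : ℕ)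
    (μ ν α β : Fin n) : Commute A (kPowLin m μ ν α β) := by
  induction m generalizing μ ν with
  | zero => exact (Commute.one_right _).smul_right _
  | succ m ih =>
    exact Commute.sum_right _ _ _ fun lam _ => Commute.sum_right _ _ _ fun ρ _ =>
      ((commute_kLin hA _ _ _ _).mul_right (ih _ _)).smul_right _

lemma kLin_commute_dLin (μ ν α β ρ σ : Fin n) : Commute (kLin μ ν α β) (dLin ρ σ) :=
  (commute_kLin (dLin_commute ρ σ) μ ν α β).symm

lemma kPowLin_commute_dLin (m : ℕ) (μ ν α β ρ σ : Fin n) :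
    Commute (kPowLin m μ ν α β) (dLin ρ σ) :=
  (commute_kPowLin (dLin_commute ρ σ) m μ ν α β).symm

/-- The degree-`k` part of `M̂_{μν}`: `Σ x_{αβ} η_{αα} η_{ββ} ∘ (K^k)_{(μν)(αβ)}`. -/
noncomputable def mLin (k : ℕ) (μ ν : Fin n) : Module.End ℝ (PolyH n) :=
  ∑ α, ∑ β, (etaM α α * etaM β β) •
    (LinearMap.mulLeft ℝ (xv α β : PolyH n) * kPowLin k μ ν α β)

lemma MhatL_eq_sum {N : ℕ} (μ ν : Fin n) {p : PolyH n} (hp : p ∈ derivKer n N) :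
    MhatL μ ν p = (∑ k ∈ Finset.range N, bcoef k • mLin k μ ν) p := by
  simp only [MhatL]
  rw [sum_etaM_mul_etaM_smul fun α β α' β' => xv α β * psiKL μ ν α' β' p]
  have h (α β : Fin n) : psiKL μ ν α β p
      = (∑ k ∈ Finset.range N, bcoef k • kPowLin k μ ν α β) p := by
    rw [← finsum_smul_apply_eq_sum _ _ (fun k => kPowLin_mem_lowering k μ ν α β) hp]
    simp only [psiKL, kPowLin_apply]
  simp only [h, mLin, LinearMap.sum_apply, LinearMap.smul_apply, Module.End.mul_apply,
    LinearMap.mulLeft_apply, Finset.mul_sum, Finset.smul_sum, mul_smul_comm]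
  refine Eq.trans ?_ (Finset.sum_comm.trans (Finset.sum_congr rfl fun α _ => Finset.sum_comm)).symm
  simp only [smul_comm (bcoef _)]

end Operators

section MatrixCalculus

variable {n : ℕ}

/-- Matrices with operator entries. -/
abbrev OpMatrix (n : ℕ) := Matrix (Fin n) (Fin n) (Module.End ℝ (PolyH n))

/-- The Minkowski metric as a matrix of operators. -/
noncomputable def etaMat (n : ℕ) : OpMatrix n := Matrix.diagonal fun μ => etaM μ μ • 1

/-- The matrix `η ∂`, whose ordinary powers give the `η`-contracted powers of `∂`. -/
noncomputable def dMat (n : ℕ) : OpMatrix n := etaMat n * Matrix.of dLin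

/-- The constant matrix `[∂_{μν}, x_{αβ}]`. -/
noncomputable def genMat (α β : Fin n) : OpMatrix n :=
  Matrix.of fun μ ν => (etaM μ α * etaM ν β - etaM μ β * etaM ν α) • 1

lemma etaMat_mul_apply (A : OpMatrix n) (μ ν : Fin n) :
    (etaMat n * A) μ ν = etaM μ μ • A μ ν := by
  rw [etaMat, Matrix.diagonal_mul, smul_one_mul]

lemma etaMat_mul_self : etaMat n * etaMat n = 1 := by
  rw [etaMat, Matrix.diagonal_mul_diagonal, ← Matrix.diagonal_one]
  congr 1
  ext1 μ
  rw [smul_one_mul, smul_smul, etaM_self_mul_self, one_smul]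

lemma dMat_apply (μ ν : Fin n) : dMat n μ ν = etaM μ μ • dLin μ ν := etaMat_mul_apply _ _ _

lemma sum_genMat_coeff_smul {V : Type*} [AddCommGroup V] [Module ℝ V] (μ ν : Fin n)
    (f : Fin n → Fin n → V) :
    ∑ α, ∑ β, (etaM α α * etaM β β) • (etaM μ α * etaM ν β - etaM μ β * etaM ν α) • f α β
      = f μ ν - f ν μ := by
  have h (μ ν : Fin n) (f : Fin n → Fin n → V) :
      ∑ α, ∑ β, (etaM μ α * etaM ν β) • (etaM α α * etaM β β) • f α β = f μ ν := by
    simp only [mul_smul, ← Finset.smul_sum, sum_etaM_smul]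
    have h1 : etaM ν ν * (etaM μ μ * (etaM μ μ * etaM ν ν)) = 1 := by
      rw [← mul_assoc (etaM μ μ), etaM_self_mul_self, one_mul, etaM_self_mul_self]
    simp only [smul_smul]
    convert one_smul ℝ (f μ ν) using 2
    rw [← h1]
    ring
  rw [← h μ ν f, ← h ν μ f, ← Finset.sum_sub_distrib]
  refine Finset.sum_congr rfl fun α _ => ?_
  rw [← Finset.sum_sub_distrib]
  refine Finset.sum_congr rfl fun β _ => ?_
  module

lemma genMat_mul_apply (α β : Fin n) (A : OpMatrix n) (μ ν : Fin n) :
    (genMat α β * A) μ ν = etaM μ α • (etaMat n * A) β ν - etaM μ β • (etaMat n * A) α ν := by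
  have h (γ : Fin n) : ∑ j, etaM γ j • A j ν = etaM γ γ • A γ ν := sum_etaM_smul γ fun j => A j ν
  rw [Matrix.mul_apply, etaMat_mul_apply, etaMat_mul_apply, ← h, ← h, Finset.smul_sum,
    Finset.smul_sum, ← Finset.sum_sub_distrib]
  refine Finset.sum_congr rfl fun j _ => ?_
  rw [genMat, Matrix.of_apply, smul_one_mul, etaM_comm j, etaM_comm j]
  module

lemma mul_etaMat_genMat_apply (α β : Fin n) (A : OpMatrix n) (μ ν : Fin n) :
    (A * (etaMat n * genMat α β)) μ ν = etaM ν β • A μ α - etaM ν α • A μ β := by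
  have h (γ : Fin n) : ∑ j, etaM γ j • etaM j j • A μ j = A μ γ := by
    rw [sum_etaM_smul γ fun j => etaM j j • A μ j, smul_smul, etaM_self_mul_self, one_smul]
  rw [Matrix.mul_apply, ← h α, ← h β, Finset.smul_sum, Finset.smul_sum, ← Finset.sum_sub_distrib]
  refine Finset.sum_congr rfl fun j _ => ?_
  rw [etaMat_mul_apply, genMat, Matrix.of_apply, mul_smul_comm, mul_smul_comm, mul_one,
    etaM_comm j α, etaM_comm j β]
  module

/-- Matrix form of `[∂_{μν}, x_{αβ}] = η_{μα}η_{νβ} - η_{μβ}η_{να}`. -/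
lemma dMat_mul_scalar_xv (α β : Fin n) :
    dMat n * Matrix.scalar (Fin n) (LinearMap.mulLeft ℝ (xv α β : PolyH n))
      - Matrix.scalar (Fin n) (LinearMap.mulLeft ℝ (xv α β : PolyH n)) * dMat n
      = etaMat n * genMat α β := by
  ext1 μ ν
  rw [Matrix.sub_apply, Matrix.scalar_apply, Matrix.mul_diagonal, Matrix.diagonal_mul,
    etaMat_mul_apply, dMat_apply, mul_smul_comm, smul_mul_assoc]
  refine (smul_sub _ _ _).symm.trans (congrArg (etaM μ μ • ·) (LinearMap.ext fun p => ?_))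
  simp [genMat, dLin_mul, dLin_xv, smul_eq_C_mul]

lemma scalar_smul (r : ℝ) (A : Module.End ℝ (PolyH n)) :
    Matrix.scalar (Fin n) (r • A) = r • Matrix.scalar (Fin n) A := by
  rw [Matrix.scalar_apply, Matrix.scalar_apply, ← Matrix.diagonal_smul]
  rfl

lemma commute_scalar_etaMat (A : Module.End ℝ (PolyH n)) :
    Commute (Matrix.scalar (Fin n) A) (etaMat n) := by
  simp [Commute, SemiconjBy, Matrix.scalar_apply, etaMat]

lemma commute_scalar_dMat {A : Module.End ℝ (PolyH n)} (hA : ∀ μ ν, Commute A (dLin μ ν)) :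
    Commute (Matrix.scalar (Fin n) A) (dMat n) := by
  ext1 μ ν
  rw [Matrix.scalar_apply, Matrix.mul_diagonal, Matrix.diagonal_mul, dMat_apply]
  exact (hA μ ν).smul_right _

/-- Contracting `K` with the constant matrices gives a commutator with `η ∂`. -/
lemma sum_genMat_mul_scalar_kLin (μ ν : Fin n) :
    ∑ lam, ∑ ρ, (etaM lam lam * etaM ρ ρ) •
      (etaMat n * genMat lam ρ * Matrix.scalar (Fin n) (kLin μ ν lam ρ))
      = rightSubLeft (dMat n) (etaMat n * genMat μ ν) := by
  ext1 i j
  have h : ∑ lam, ∑ ρ, (etaM lam lam * etaM ρ ρ) •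
      (etaMat n * genMat lam ρ * Matrix.scalar (Fin n) (kLin μ ν lam ρ)) i j
      = etaM i i • (kLin μ ν i j - kLin μ ν j i) := by
    rw [← sum_genMat_coeff_smul, Finset.smul_sum]
    refine Finset.sum_congr rfl fun lam _ => ?_
    rw [Finset.smul_sum]
    refine Finset.sum_congr rfl fun ρ _ => ?_
    rw [Matrix.scalar_apply, Matrix.mul_diagonal, etaMat_mul_apply, genMat, Matrix.of_apply,
      smul_mul_assoc, smul_one_mul]
    module
  rw [rightSubLeft_apply, Matrix.sub_apply, mul_etaMat_genMat_apply, mul_assoc, etaMat_mul_apply,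
    genMat_mul_apply, dMat, ← mul_assoc, etaMat_mul_self, one_mul, etaMat_mul_apply,
    etaMat_mul_apply]
  simp only [Matrix.sum_apply, Matrix.smul_apply, Matrix.of_apply]
  rw [h, kLin, kLin, dLin_antisymm μ i, dLin_antisymm ν i, etaM_comm i μ, etaM_comm i ν,
    etaM_comm j μ, etaM_comm j ν]
  module

lemma sum_sum_sum_sum_comm {ι V : Type*} [Fintype ι] [AddCommMonoid V] (f : ι → ι → ι → ι → V) :
    ∑ a, ∑ b, ∑ c, ∑ d, f a b c d = ∑ c, ∑ d, ∑ a, ∑ b, f a b c d :=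
  calc _ = ∑ a, ∑ c, ∑ b, ∑ d, f a b c d := Finset.sum_congr rfl fun _ _ => Finset.sum_comm
    _ = ∑ c, ∑ a, ∑ b, ∑ d, f a b c d := Finset.sum_comm
    _ = ∑ c, ∑ a, ∑ d, ∑ b, f a b c d := Finset.sum_congr rfl fun _ _ =>
      Finset.sum_congr rfl fun _ _ => Finset.sum_comm
    _ = _ := Finset.sum_congr rfl fun _ _ => Finset.sum_comm

lemma sum_genMat_mul_scalar_kPowLin (k : ℕ) (μ ν : Fin n) :
    ∑ α, ∑ β, (etaM α α * etaM β β) •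
      (etaMat n * genMat α β * Matrix.scalar (Fin n) (kPowLin k μ ν α β))
      = (rightSubLeft (dMat n) ^ k) (etaMat n * genMat μ ν) := by
  induction k generalizing μ ν with
  | zero =>
    have h := sum_genMat_coeff_smul μ ν fun α β => (1 / 2 : ℝ) • (etaMat n * genMat α β)
    have hs : genMat ν μ = -genMat μ ν := by
      ext1 i j
      simp only [genMat, Matrix.of_apply, Matrix.neg_apply]
      module
    rw [hs, Matrix.mul_neg] at h
    rw [pow_zero, Module.End.one_apply]
    refine Eq.trans ?_ (h.trans (by module))
    refine Finset.sum_congr rfl fun α _ => Finset.sum_congr rfl fun β _ => ?_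
    rw [kPowLin, scalar_smul, map_one, mul_smul_comm, mul_one]
    module
  | succ k ih =>
    have hcomm (lam ρ : Fin n) : ((rightSubLeft (dMat n)) ^ k)
        (etaMat n * genMat lam ρ * Matrix.scalar (Fin n) (kLin μ ν lam ρ))
        = ((rightSubLeft (dMat n)) ^ k) (etaMat n * genMat lam ρ)
          * Matrix.scalar (Fin n) (kLin μ ν lam ρ) :=
      rightSubLeft_pow_mul (commute_scalar_dMat (kLin_commute_dLin μ ν lam ρ)) _ k
    rw [pow_succ, Module.End.mul_apply, ← sum_genMat_mul_scalar_kLin]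
    simp only [map_sum, map_smul, hcomm, ← ih, Finset.sum_mul, smul_mul_assoc, kPowLin,
      scalar_smul, map_mul, Finset.mul_sum, mul_smul_comm, Finset.smul_sum]
    rw [sum_sum_sum_sum_comm]
    refine Finset.sum_congr rfl fun lam _ => Finset.sum_congr rfl fun ρ _ =>
      Finset.sum_congr rfl fun α _ => Finset.sum_congr rfl fun β _ => ?_
    have hc : Commute (kLin μ ν lam ρ) (kPowLin k lam ρ α β) :=
      commute_kPowLin (kLin_commute_dLin μ ν lam ρ) k lam ρ α β
    rw [← map_mul, hc.eq, map_mul, smul_comm, mul_assoc (etaMat n * genMat α β)]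

/-- The `η`-contracted matrix powers of `∂`. -/
noncomputable def dPowMat (n m : ℕ) : OpMatrix n := etaMat n * dMat n ^ m

lemma dPowMat_succ_apply (m : ℕ) (μ ν : Fin n) :
    dPowMat n (m + 1) μ ν = ∑ α, etaM α α • (dPowMat n m μ α * dLin α ν) := by
  rw [dPowMat, pow_succ, ← mul_assoc, ← dPowMat, Matrix.mul_apply]
  simp only [dMat_apply, mul_smul_comm]

lemma dPowMat_zero_apply (μ ν : Fin n) : dPowMat n 0 μ ν = etaM μ ν • 1 := by
  rw [dPowMat, pow_zero, mul_one, etaMat, Matrix.diagonal_apply]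
  split_ifs with h
  · rw [h]
  · rw [etaM_of_ne h, zero_smul]

lemma dPowMat_apply (m : ℕ) (μ ν : Fin n) (p : PolyH n) :
    dPowMat n m μ ν p = dmatpowL m μ ν p := by
  induction m generalizing ν p with
  | zero => rw [dPowMat_zero_apply]; rfl
  | succ m ih =>
    simp only [dmatpowL, dPowMat_succ_apply, LinearMap.sum_apply, LinearMap.smul_apply,
      Module.End.mul_apply, ih, dLin_apply]
    exact Finset.sum_congr rfl fun α _ =>
      (sum_etaM_smul α fun β => dmatpowL m μ α (dopL β ν p)).symm

lemma dPowMat_mem_lowering (m : ℕ) (μ ν : Fin n) : dPowMat n m μ ν ∈ lowering n m := by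
  induction m generalizing ν with
  | zero =>
    rw [dPowMat_zero_apply]
    exact Submodule.smul_mem _ _ one_mem_lowering
  | succ m ih =>
    rw [dPowMat_succ_apply]
    exact Submodule.sum_mem _ fun α _ => Submodule.smul_mem _ _
      (mul_mem_lowering (ih α) (dLin_mem_lowering _ _))

lemma commute_dPowMat {A : Module.End ℝ (PolyH n)} (hA : ∀ μ ν, Commute A (dLin μ ν)) (m : ℕ)
    (μ ν : Fin n) : Commute A (dPowMat n m μ ν) := by
  induction m generalizing ν with
  | zero =>
    rw [dPowMat_zero_apply]
    exact (Commute.one_right A).smul_right _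
  | succ m ih =>
    rw [dPowMat_succ_apply]
    exact Commute.sum_right _ _ _ fun α _ => ((ih α).mul_right (hA _ _)).smul_right _

lemma dPowMat_commute_dPowMat (m m' : ℕ) (μ ν ρ σ : Fin n) :
    Commute (dPowMat n m μ ν) (dPowMat n m' ρ σ) :=
  commute_dPowMat (fun α β => (commute_dPowMat (dLin_commute α β) m μ ν).symm) m' ρ σ

lemma LhatL_eq_sum {N : ℕ} (μ ν : Fin n) {p : PolyH n} (hp : p ∈ derivKer n N) :
    LhatL μ ν p = (∑ m ∈ Finset.range N, ((m.factorial : ℝ))⁻¹ • dPowMat n m μ ν) p := by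
  rw [← finsum_smul_apply_eq_sum _ _ (fun m => dPowMat_mem_lowering m μ ν) hp]
  simp only [LhatL, dPowMat_apply]

/-- The commutator of the homogeneous parts of `M̂_{μν}` and of `Λ̂`. -/
lemma rightSubLeft_dPowMat_scalar_mLin (k m : ℕ) (μ ν : Fin n) :
    rightSubLeft (dPowMat n m) (Matrix.scalar (Fin n) (mLin k μ ν))
      = -(etaMat n * sandwichSum (dMat n) m
          ((rightSubLeft (dMat n) ^ k) (etaMat n * genMat μ ν))) := by
  let Ψ : Module.End ℝ (OpMatrix n) := -(LinearMap.mulLeft ℝ (etaMat n) * sandwichSum (dMat n) m)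
  have h (α β : Fin n) : rightSubLeft (dPowMat n m) (Matrix.scalar (Fin n)
        (LinearMap.mulLeft ℝ (xv α β : PolyH n) * kPowLin k μ ν α β))
      = Ψ (etaMat n * genMat α β * Matrix.scalar (Fin n) (kPowLin k μ ν α β)) := by
    rw [map_mul, dPowMat]
    exact rightSubLeft_mul_pow_apply (commute_scalar_dMat (kPowLin_commute_dLin k μ ν α β))
      (commute_scalar_etaMat _) (commute_scalar_etaMat _) (dMat_mul_scalar_xv α β) m
  change _ = Ψ _
  rw [← sum_genMat_mul_scalar_kPowLin, mLin]
  simp only [map_sum, map_smul, scalar_smul, h]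

/-- The degree-`N` part of the commutator of `M̂_{μν}` with `Λ̂`. -/
lemma sum_antidiagonal_rightSubLeft (N : ℕ) (μ ν : Fin n) :
    ∑ x ∈ Finset.HasAntidiagonal.antidiagonal (N + 1), (bcoef x.1 * ((x.2.factorial : ℝ))⁻¹) •
        rightSubLeft (dPowMat n x.2) (Matrix.scalar (Fin n) (mLin x.1 μ ν))
      = ((N.factorial : ℝ))⁻¹ • -(genMat μ ν * dMat n ^ N) := by
  let Φ : Module.End ℝ (OpMatrix n) := -LinearMap.mulLeft ℝ (etaMat n)
  have h := congrArg Φ (sum_bcoef_smul_rightSubLeft (dMat n) (etaMat n * genMat μ ν) N)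
  have hΦ : Φ (etaMat n * genMat μ ν * dMat n ^ N) = -(genMat μ ν * dMat n ^ N) := by
    change -(etaMat n * _) = _
    rw [← mul_assoc, ← mul_assoc, etaMat_mul_self, one_mul]
  simp only [← sandwichSum_apply] at h
  rw [map_smul, hΦ] at h
  rw [← h, map_sum]
  refine Finset.sum_congr rfl fun x _ => ?_
  rw [map_smul, rightSubLeft_dPowMat_scalar_mLin]
  rfl

lemma rightSubLeft_scalar_apply (A : OpMatrix n) (c : Module.End ℝ (PolyH n)) (ρ σ : Fin n) :
    rightSubLeft A (Matrix.scalar (Fin n) c) ρ σ = c * A ρ σ - A ρ σ * c := by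
  rw [rightSubLeft_apply, Matrix.sub_apply, Matrix.scalar_apply, Matrix.mul_diagonal,
    Matrix.diagonal_mul]

/-- The degree-`N` part of the commutation relation between `M̂_{μν}` and `Λ̂_{ρσ}`. -/
lemma sum_antidiagonal_commutator (N : ℕ) (μ ν ρ σ : Fin n) :
    ∑ x ∈ Finset.HasAntidiagonal.antidiagonal (N + 1), (bcoef x.1 * ((x.2.factorial : ℝ))⁻¹) •
        (mLin x.1 μ ν * dPowMat n x.2 ρ σ - dPowMat n x.2 ρ σ * mLin x.1 μ ν)
      = ((N.factorial : ℝ))⁻¹ •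
        (etaM ν ρ • dPowMat n N μ σ - etaM μ ρ • dPowMat n N ν σ) := by
  have h := congrFun (congrFun (sum_antidiagonal_rightSubLeft N μ ν) ρ) σ
  simp only [Matrix.sum_apply, Matrix.smul_apply, Matrix.neg_apply, rightSubLeft_scalar_apply,
    genMat_mul_apply] at h
  rw [h, dPowMat, etaM_comm ν, etaM_comm μ]
  module

end MatrixCalculus

section Truncation

variable {n : ℕ}

lemma sum_range_sum_range_eq_sum_antidiagonal {V : Type*} [AddCommMonoid V] (N : ℕ)
    (f : ℕ → ℕ → V) (hf : ∀ k m, N ≤ k + m → f k m = 0) :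
    ∑ k ∈ Finset.range N, ∑ m ∈ Finset.range N, f k m
      = ∑ j ∈ Finset.range N, ∑ x ∈ Finset.HasAntidiagonal.antidiagonal j, f x.1 x.2 := by
  classical
  have h (x) (_ : x ∈ Finset.range N ×ˢ Finset.range N) (hx : f x.1 x.2 ≠ 0) : x.1 + x.2 < N :=
    not_le.1 fun hN => hx (hf _ _ hN)
  rw [← Finset.sum_product', ← Finset.sum_filter_of_ne h,
    ← Finset.sum_fiberwise_of_maps_to (t := Finset.range N) (g := fun x => x.1 + x.2)]
  · refine Finset.sum_congr rfl fun j hj => Finset.sum_congr ?_ fun _ _ => rfl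
    ext x
    simp only [Finset.mem_filter, Finset.mem_product, Finset.mem_range,
      Finset.HasAntidiagonal.mem_antidiagonal] at hj ⊢
    omega
  · intro x hx
    simpa using (Finset.mem_filter.1 hx).2

lemma mLin_apply (k : ℕ) (μ ν : Fin n) (p : PolyH n) :
    mLin k μ ν p = ∑ α, ∑ β, (etaM α α * etaM β β) • (xv α β * kPowLin k μ ν α β p) := by
  simp [mLin, LinearMap.sum_apply]

lemma mLin_apply_eq_zero {k N : ℕ} (hN : N ≤ k) (μ ν : Fin n) {p : PolyH n}
    (hp : p ∈ derivKer n N) : mLin k μ ν p = 0 := by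
  rw [mLin_apply]
  refine Finset.sum_eq_zero fun α _ => Finset.sum_eq_zero fun β _ => ?_
  rw [apply_eq_zero_of_mem_lowering (kPowLin_mem_lowering k μ ν α β) hN hp, mul_zero, smul_zero]

lemma mLin_apply_mem_derivKer {k N : ℕ} (μ ν : Fin n) {p : PolyH n}
    (hp : p ∈ derivKer n (N + k)) : mLin k μ ν p ∈ derivKer n (N + 1) := by
  rw [mLin_apply]
  exact Submodule.sum_mem _ fun α _ => Submodule.sum_mem _ fun β _ => Submodule.smul_mem _ _
    (xv_mul_mem_derivKer α β (kPowLin_mem_lowering k μ ν α β N p hp))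

lemma commutator_apply_eq_zero {k m N : ℕ} (h : N + 1 ≤ k + m) (μ ν ρ σ : Fin n) {p : PolyH n}
    (hp : p ∈ derivKer n N) :
    (mLin k μ ν * dPowMat n m ρ σ - dPowMat n m ρ σ * mLin k μ ν) p = 0 := by
  rw [LinearMap.sub_apply, Module.End.mul_apply, Module.End.mul_apply]
  have h1 : mLin k μ ν (dPowMat n m ρ σ p) = 0 := by
    refine mLin_apply_eq_zero le_rfl μ ν
      (dPowMat_mem_lowering m ρ σ k p (derivKer_mono (by omega) hp))
  have h2 : dPowMat n m ρ σ (mLin k μ ν p) = 0 := by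
    rcases le_total N k with hk | hk
    · rw [mLin_apply_eq_zero hk μ ν hp, map_zero]
    · exact apply_eq_zero_of_mem_lowering (dPowMat_mem_lowering m ρ σ)
        (show N - k + 1 ≤ m by omega)
        (mLin_apply_mem_derivKer μ ν (by rwa [Nat.sub_add_cancel hk]))
  rw [h1, h2, sub_zero]

lemma LhatL_mem_derivKer {N : ℕ} (μ ν : Fin n) {p : PolyH n} (hp : p ∈ derivKer n N) :
    LhatL μ ν p ∈ derivKer n N := by
  rw [LhatL_eq_sum μ ν hp, LinearMap.sum_apply]
  exact Submodule.sum_mem _ fun m _ => Submodule.smul_mem _ _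
    (apply_mem_derivKer_of_mem_lowering (dPowMat_mem_lowering m μ ν) hp)

lemma MhatL_mem_derivKer {N : ℕ} (μ ν : Fin n) {p : PolyH n} (hp : p ∈ derivKer n N) :
    MhatL μ ν p ∈ derivKer n (N + 1) := by
  rw [MhatL_eq_sum μ ν hp, LinearMap.sum_apply]
  exact Submodule.sum_mem _ fun k _ => Submodule.smul_mem _ _
    (mLin_apply_mem_derivKer μ ν (derivKer_mono (by omega) hp))

lemma MhatL_LhatL_commutator_apply (μ ν ρ σ : Fin n) (p : PolyH n) :
    MhatL μ ν (LhatL ρ σ p) - LhatL ρ σ (MhatL μ ν p)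
      = etaM ν ρ • LhatL μ σ p - etaM μ ρ • LhatL ν σ p := by
  obtain ⟨N, hp⟩ := exists_mem_derivKer p
  have hp' : p ∈ derivKer n (N + 1) := derivKer_mono N.le_succ hp
  let T (k m : ℕ) : PolyH n := (bcoef k * ((m.factorial : ℝ))⁻¹) •
    (mLin k μ ν * dPowMat n m ρ σ - dPowMat n m ρ σ * mLin k μ ν) p
  have hT : MhatL μ ν (LhatL ρ σ p) - LhatL ρ σ (MhatL μ ν p)
      = ∑ k ∈ Finset.range (N + 1), ∑ m ∈ Finset.range (N + 1), T k m := by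
    rw [MhatL_eq_sum μ ν (LhatL_mem_derivKer ρ σ hp'), LhatL_eq_sum ρ σ hp',
      LhatL_eq_sum ρ σ (MhatL_mem_derivKer μ ν hp), MhatL_eq_sum μ ν hp']
    simp only [LinearMap.sum_apply, LinearMap.smul_apply, map_sum, map_smul, Finset.smul_sum]
    conv_lhs => arg 1; rw [Finset.sum_comm]
    simp only [← Finset.sum_sub_distrib]
    refine Finset.sum_congr rfl fun k _ => Finset.sum_congr rfl fun m _ => ?_
    simp only [T, LinearMap.sub_apply, Module.End.mul_apply]
    module
  have hT0 : T 0 0 = 0 := by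
    have : Commute (mLin 0 μ ν) (dPowMat n 0 ρ σ) := by
      rw [dPowMat_zero_apply]
      exact (Commute.one_right _).smul_right _
    simp only [T, this.eq, sub_self, LinearMap.zero_apply, smul_zero]
  rw [hT, sum_range_sum_range_eq_sum_antidiagonal, Finset.sum_range_succ',
    Finset.Nat.antidiagonal_zero, Finset.sum_singleton, hT0, add_zero, LhatL_eq_sum μ σ hp,
    LhatL_eq_sum ν σ hp, LinearMap.sum_apply, LinearMap.sum_apply, Finset.smul_sum,
    Finset.smul_sum, ← Finset.sum_sub_distrib]
  · refine Finset.sum_congr rfl fun j _ => ?_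
    have h := LinearMap.congr_fun (sum_antidiagonal_commutator j μ ν ρ σ) p
    rw [LinearMap.sum_apply] at h
    refine h.trans ?_
    simp only [LinearMap.smul_apply, LinearMap.sub_apply]
    module
  · intro k m h
    simp only [T, commutator_apply_eq_zero h μ ν ρ σ hp, smul_zero]

lemma LhatL_comm_apply (μ ν ρ σ : Fin n) (p : PolyH n) :
    LhatL μ ν (LhatL ρ σ p) = LhatL ρ σ (LhatL μ ν p) := by
  obtain ⟨N, hp⟩ := exists_mem_derivKer p
  rw [LhatL_eq_sum μ ν (LhatL_mem_derivKer ρ σ hp), LhatL_eq_sum ρ σ hp,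
    LhatL_eq_sum ρ σ (LhatL_mem_derivKer μ ν hp), LhatL_eq_sum μ ν hp, ← Module.End.mul_apply,
    ← Module.End.mul_apply]
  congr 1
  exact Commute.sum_left _ _ _ fun m _ => Commute.sum_right _ _ _ fun m' _ =>
    ((dPowMat_commute_dPowMat m m' μ ν ρ σ).smul_left _).smul_right _

end Truncation

/-- `M̂_{μν}` and `Λ̂_{μν}` realize the Lorentz algebra extended by
quantum angles: `[M̂_{μν},Λ̂_{ρσ}] = η_{νρ}Λ̂_{μσ} - η_{μρ}Λ̂_{νσ}`, `[Λ̂,Λ̂] = 0`. -/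
theorem statement17 (n : ℕ) (hn : 2 ≤ n) :
    (∀ μ ν ρ σ : Fin n,
      MhatL μ ν ∘ LhatL ρ σ - LhatL ρ σ ∘ MhatL μ ν
        = etaM ν ρ • LhatL μ σ - etaM μ ρ • LhatL ν σ) ∧
    (∀ μ ν ρ σ : Fin n,
      LhatL μ ν ∘ LhatL ρ σ - LhatL ρ σ ∘ LhatL μ ν = 0) := by
  refine ⟨fun μ ν ρ σ => funext fun p => MhatL_LhatL_commutator_apply μ ν ρ σ p,
    fun μ ν ρ σ => funext fun p => sub_eq_zero.2 (LhatL_comm_apply μ ν ρ σ p)⟩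
end
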